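/- Let Γ be a virtually ℤ group acting minimally, topologically freely and continuously on an infinite compact metrizable space X with the small boundary property. Then the action is almost finite. -/

import Mathlib

open scoped Pointwise
open MeasureTheory

namespace Paper

section Basic

variable (G : Type*) [Group G] (X : Type*) [TopologicalSpace X] [MulAction G X]

/-- The action is minimal: every orbit is dense. -/
def Minimal : Prop := ∀ x : X, Dense (MulAction.orbit G x)

/-- The action is topologically free: every nontrivial fixed-point set is nowhere dense. -/
def TopFree : Prop := ∀ g : G, g ≠ 1 → interior (closure {x : X | g • x = x}) = (∅ : Set X)

variable [MeasurableSpace X]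

/-- `μ` is a `G`-invariant Borel probability measure. -/
def InvProb (μ : Measure X) : Prop :=
  IsProbabilityMeasure μ ∧ ∀ g : G, Measure.map (fun x : X => g • x) μ = μ

/-- The action is essentially free. -/
def EssFree : Prop :=
  ∀ g : G, g ≠ 1 → ∀ μ : Measure X, InvProb G X μ → μ {x : X | g • x = x} = 0

/-- The small boundary property. -/
def SBP : Prop :=
  ∀ (x : X) (U : Set X), IsOpen U → x ∈ U →
    ∃ V : Set X, IsOpen V ∧ x ∈ V ∧ V ⊆ U ∧
      ∀ μ : Measure X, InvProb G X μ → μ (frontier V) = 0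

end Basic

/-- `S` is a `(K, ε)`-Følner set: `|KS \ S| < ε |S|`. -/
def IsFolner {G : Type*} [Group G] (K S : Finset G) (ε : ℝ) : Prop :=
  letI := Classical.decEq G
  (((K * S) \ S).card : ℝ) < ε * S.card

/-- Amenability in the Følner sense. -/
def FolnerAmenable (G : Type*) [Group G] : Prop :=
  ∀ (K : Finset G) (ε : ℝ), 0 < ε → ∃ S : Finset G, IsFolner K S ε

/-- A finite family of towers forming a castle: all levels are pairwise disjoint. -/
def IsCastle (G : Type*) [Group G] (X : Type*) [MulAction G X] {n : ℕ}
    (S : Fin n → Finset G) (B : Fin n → Set X) : Prop :=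
  ∀ (i j : Fin n), ∀ s ∈ S i, ∀ t ∈ S j, (i, s) ≠ (j, t) → Disjoint (s • B i) (t • B j)

/-- The union of all levels of a castle. -/
def CastleUnion (G : Type*) [Group G] (X : Type*) [MulAction G X] {n : ℕ}
    (S : Fin n → Finset G) (B : Fin n → Set X) : Set X :=
  ⋃ i, ⋃ s ∈ S i, s • B i

/-- `C ≺ O` : dynamical subordination of a (closed) set `C` to `O`. -/
def Subord (G : Type*) [Group G] (X : Type*) [TopologicalSpace X] [MulAction G X]
    (C O : Set X) : Prop :=
  ∃ (n : ℕ) (V : Fin n → Set X) (g : Fin n → G),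
    (∀ k, IsOpen (V k)) ∧ (C ⊆ ⋃ k, V k) ∧ (∀ k, g k • V k ⊆ O) ∧
      Pairwise fun k l => Disjoint (g k • V k) (g l • V l)

/-- `U ≺ O` for open `U`: every closed subset of `U` is subordinate to `O`. -/
def SubordOpen (G : Type*) [Group G] (X : Type*) [TopologicalSpace X] [MulAction G X]
    (U O : Set X) : Prop :=
  ∀ C : Set X, IsClosed C → C ⊆ U → Subord G X C O

/-- Dynamical comparison. -/
def DynComparison (G : Type*) [Group G] (X : Type*) [TopologicalSpace X] [MulAction G X]
    [MeasurableSpace X] : Prop :=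
  ∀ U O : Set X, IsOpen U → IsOpen O → U.Nonempty → O.Nonempty →
    (∀ μ : Measure X, InvProb G X μ → μ U < μ O) → SubordOpen G X U O

/-- Almost finiteness (Kerr). -/
def AlmostFinite (G X : Type*) [Group G] [MetricSpace X] [MulAction G X] : Prop :=
  ∀ (K : Finset G) (m : ℕ), 0 < m → ∀ ε : ℝ, 0 < ε →
    ∃ (n : ℕ) (S : Fin n → Finset G) (B : Fin n → Set X),
      IsCastle G X S B ∧ (∀ i, IsOpen (B i)) ∧ (∀ i, IsFolner K (S i) ε) ∧
      (∀ i, ∀ s ∈ S i, Metric.diam (s • B i) < ε) ∧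
      ∃ S' : Fin n → Finset G,
        (∀ i, S' i ⊆ S i ∧ ((S' i).card : ℝ) < (S i).card / m) ∧
        Subord G X (Set.univ \ CastleUnion G X S B) (CastleUnion G X S' B)

/-- Almost finiteness in measure (Kerr–Szabó). -/
def AlmostFiniteInMeasure (G X : Type*) [Group G] [MetricSpace X] [MulAction G X]
    [MeasurableSpace X] : Prop :=
  ∀ (K : Finset G) (ε : ℝ), 0 < ε →
    ∃ (n : ℕ) (S : Fin n → Finset G) (B : Fin n → Set X),
      IsCastle G X S B ∧ (∀ i, IsOpen (B i)) ∧ (∀ i, IsFolner K (S i) ε) ∧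
      (∀ i, ∀ s ∈ S i, Metric.diam (s • B i) < ε) ∧
      (⨆ μ : {μ : Measure X // InvProb G X μ},
        (μ : Measure X) (Set.univ \ CastleUnion G X S B)) < ENNReal.ofReal ε

/-- Every finitely generated subgroup is finite. -/
def LocallyFiniteGroup (G : Type*) [Group G] : Prop :=
  ∀ H : Subgroup G, H.FG → (H : Set G).Finite

/-- `G` is virtually `ℤ`. -/
def VirtuallyZ (G : Type*) [Group G] : Prop :=
  ∃ H : Subgroup G, H.FiniteIndex ∧ Nonempty (H ≃* Multiplicative ℤ)

end Paper

namespace Paper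

/-- `t` generates an infinite cyclic normal subgroup of finite index, and `E` is a transversal. -/
structure IsZTransversal {G : Type*} [Group G] (t : G) (E : Finset G) : Prop where
  inj : ∀ i j : ℤ, ∀ e ∈ E, ∀ f ∈ E, t ^ i * e = t ^ j * f → i = j ∧ e = f
  surj : ∀ g : G, ∃ i : ℤ, ∃ e ∈ E, t ^ i * e = g
  conj : ∀ g : G, (∀ i : ℤ, g * t ^ i = t ^ i * g) ∨ (∀ i : ℤ, g * t ^ i = t ^ (-i) * g)

theorem VirtuallyZ.exists_isZTransversal {G : Type*} [Group G] (h : VirtuallyZ G) :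
    ∃ (t : G) (E : Finset G), IsZTransversal t E := by
  classical
  obtain ⟨H₀, hfin, ⟨φ⟩⟩ := h
  have hG : Infinite G :=
    have : Infinite H₀ := Infinite.of_injective φ.symm φ.symm.injective
    Infinite.of_injective (Subtype.val : H₀ → G) Subtype.val_injective
  set H := H₀.normalCore with hH
  have hcyc : IsCyclic H₀ := isCyclic_of_surjective φ.symm φ.symm.surjective
  have hcycH : IsCyclic H := by
    have : IsCyclic (H.subgroupOf H₀) := inferInstance
    exact isCyclic_of_surjective (Subgroup.subgroupOfEquivOfLe H₀.normalCore_le)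
      (Subgroup.subgroupOfEquivOfLe H₀.normalCore_le).surjective
  obtain ⟨⟨t, htH⟩, ht⟩ := hcycH.exists_generator
  have hzp : ∀ g, g ∈ H ↔ ∃ i : ℤ, t ^ i = g := by
    intro g
    constructor
    · intro hg
      obtain ⟨i, hi⟩ := ht ⟨g, hg⟩
      exact ⟨i, by simpa using congrArg Subtype.val hi⟩
    · rintro ⟨i, rfl⟩
      exact H.zpow_mem htH i
  have hHinf : Infinite H := by
    by_contra hcon
    rw [not_infinite_iff_finite] at hcon
    have : Finite G := (Subgroup.finite_iff_finite_and_finiteIndex H).2 ⟨hcon, inferInstance⟩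
    exact not_finite G
  have hord : ¬ IsOfFinOrder t := by
    intro hcon
    have hz : Finite (Subgroup.zpowers t) := hcon.finite_zpowers.to_subtype
    have : H ≤ Subgroup.zpowers t := fun g hg => by
      obtain ⟨i, hi⟩ := (hzp g).1 hg
      exact ⟨i, hi⟩
    have : Finite H := Finite.of_injective _ (Subgroup.inclusion_injective this)
    exact not_finite H
  have hinj : Function.Injective fun i : ℤ => t ^ i := injective_zpow_iff_not_isOfFinOrder.2 hord
  have hnorm : H.Normal := inferInstance
  have : Finite (G ⧸ H) := inferInstance
  have := Fintype.ofFinite (G ⧸ H)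
  have hconj1 : ∀ g : G, g * t * g⁻¹ = t ∨ g * t * g⁻¹ = t⁻¹ := by
    intro g
    obtain ⟨k, hk⟩ := (hzp _).1 (hnorm.conj_mem t htH g)
    obtain ⟨l, hl⟩ := (hzp _).1 (hnorm.conj_mem t htH g⁻¹)
    have h1 : t ^ (k * l) = t ^ (1 : ℤ) := by
      rw [zpow_mul, hk, conj_zpow, hl]
      group
    have h2 : k * l = 1 := hinj h1
    rcases Int.eq_one_or_neg_one_of_mul_eq_one h2 with h | h
    · left; rw [← hk, h, zpow_one]
    · right; rw [← hk, h, zpow_neg_one]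
  have hq : ∀ g : G, ∃ i : ℤ, t ^ i * (g : G ⧸ H).out = g := by
    intro g
    obtain ⟨h, hh⟩ := QuotientGroup.mk_out_eq_mul H g
    have hm : g * (g : G ⧸ H).out⁻¹ ∈ H := by
      rw [hh, mul_inv_rev, ← mul_assoc]
      exact hnorm.conj_mem _ (H.inv_mem h.2) g
    obtain ⟨i, hi⟩ := (hzp _).1 hm
    exact ⟨i, by rw [hi]; group⟩
  refine ⟨t, Finset.univ.image fun q : G ⧸ H => q.out, ?_, ?_, ?_⟩
  · intro i j e he f hf hef
    simp only [Finset.mem_image, Finset.mem_univ, true_and] at he hf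
    obtain ⟨q, rfl⟩ := he
    obtain ⟨r, rfl⟩ := hf
    have hqr : q = r := by
      rw [← Quotient.out_eq' q, ← Quotient.out_eq' r]
      apply QuotientGroup.eq.2
      have : (q.out)⁻¹ * r.out = (q.out)⁻¹ * t ^ (i - j) * ((q.out)⁻¹)⁻¹ := by
        have : r.out = t ^ (-j) * (t ^ i * q.out) := by rw [hef]; group
        rw [this]; group
      rw [this]
      exact hnorm.conj_mem _ ((hzp _).2 ⟨_, rfl⟩) _
    subst hqr
    exact ⟨hinj (mul_right_cancel hef), rfl⟩
  · intro g
    obtain ⟨i, hi⟩ := hq g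
    exact ⟨i, _, Finset.mem_image_of_mem _ (Finset.mem_univ (g : G ⧸ H)), hi⟩
  · intro g
    rcases hconj1 g with h | h
    · refine Or.inl fun i => ?_
      have : (g * t * g⁻¹) ^ i = t ^ i := by rw [h]
      rwa [conj_zpow, mul_inv_eq_iff_eq_mul] at this
    · refine Or.inr fun i => ?_
      have : (g * t * g⁻¹) ^ i = t ^ (-i) := by rw [h]; simp
      rwa [conj_zpow, mul_inv_eq_iff_eq_mul] at this

section Slab

variable {G : Type*} [Group G]

open scoped Classical in
/-- The union of the cosets of the transversal `E` at heights in `I`. -/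
noncomputable def slab (t : G) (E : Finset G) (I : Finset ℤ) : Finset G :=
  (I ×ˢ E).image fun p => t ^ p.1 * p.2

/-- The symmetric slab of height `2 * N + 1`. -/
noncomputable def box (t : G) (E : Finset G) (N : ℕ) : Finset G :=
  slab t E (Finset.Icc (-(N : ℤ)) N)

open scoped Classical in
/-- The finite set of quotients `a⁻¹ * b`, for `a` and `b` in the two boxes. -/
noncomputable def boxQuot (t : G) (E : Finset G) (N M : ℕ) : Finset G :=
  (box t E N)⁻¹ * box t E M

variable {t : G} {E : Finset G}

theorem mem_slab {I : Finset ℤ} {g : G} :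
    g ∈ slab t E I ↔ ∃ i ∈ I, ∃ e ∈ E, t ^ i * e = g := by
  simp only [slab, Finset.mem_image, Finset.mem_product, Prod.exists]
  constructor
  · rintro ⟨i, e, ⟨hi, he⟩, h⟩; exact ⟨i, hi, e, he, h⟩
  · rintro ⟨i, hi, e, he, h⟩; exact ⟨i, e, ⟨hi, he⟩, h⟩

theorem mem_box {N : ℕ} {g : G} :
    g ∈ box t E N ↔ ∃ i : ℤ, |i| ≤ N ∧ ∃ e ∈ E, t ^ i * e = g := by
  simp only [box, mem_slab, Finset.mem_Icc, abs_le]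

theorem slab_mono {I J : Finset ℤ} (h : I ⊆ J) : slab t E I ⊆ slab t E J := by
  intro g hg
  obtain ⟨i, hi, he⟩ := mem_slab.1 hg
  exact mem_slab.2 ⟨i, h hi, he⟩

theorem box_mono {N M : ℕ} (h : N ≤ M) : box t E N ⊆ box t E M :=
  slab_mono (Finset.Icc_subset_Icc (by omega) (by omega))

namespace IsZTransversal

variable (hE : IsZTransversal t E)
include hE

theorem card_slab (I : Finset ℤ) : (slab t E I).card = I.card * E.card := by
  classical
  rw [slab, Finset.card_image_of_injOn, Finset.card_product]
  rintro ⟨i, e⟩ h ⟨j, f⟩ h' hij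
  simp only [Finset.coe_product, Set.mem_prod, Finset.mem_coe] at h h'
  obtain ⟨h1, h2⟩ := hE.inj i j e h.2 f h'.2 hij
  rw [h1, h2]

theorem card_box (N : ℕ) : (box t E N).card = (2 * N + 1) * E.card := by
  rw [box, hE.card_slab, Int.card_Icc]
  congr 1
  omega

theorem nonempty : E.Nonempty := by
  obtain ⟨i, e, he, -⟩ := hE.surj 1
  exact ⟨e, he⟩

theorem card_pos : 0 < E.card := hE.nonempty.card_pos

theorem surj' (g : G) : ∃ i : ℤ, ∃ e ∈ E, e * t ^ i = g := by
  obtain ⟨i, e, he, rfl⟩ := hE.surj g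
  rcases hE.conj e with h | h
  · exact ⟨i, e, he, h i⟩
  · exact ⟨-i, e, he, by rw [h, neg_neg]⟩

theorem exists_mul_mem_box (K : Finset G) :
    ∃ c : ℕ, ∀ N : ℕ, ∀ k ∈ K, ∀ s ∈ box t E N, k * s ∈ box t E (N + c) := by
  choose pos elt helt hpos using hE.surj
  refine ⟨∑ k ∈ K, ∑ e ∈ E, (pos (k * e)).natAbs, ?_⟩
  intro N k hk s hs
  obtain ⟨i, hi, e, he, rfl⟩ := mem_box.1 hs
  have hle : (pos (k * e)).natAbs ≤ ∑ k ∈ K, ∑ e ∈ E, (pos (k * e)).natAbs :=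
    (Finset.single_le_sum (f := fun e => (pos (k * e)).natAbs) (fun _ _ => Nat.zero_le _) he).trans
      (Finset.single_le_sum (f := fun k => ∑ e ∈ E, (pos (k * e)).natAbs)
        (fun _ _ => Nat.zero_le _) hk)
  have key : ∀ j : ℤ, |j| = |i| → k * t ^ i = t ^ j * k →
      k * (t ^ i * e) ∈ box t E (N + ∑ k ∈ K, ∑ e ∈ E, (pos (k * e)).natAbs) := by
    intro j hj hk
    refine mem_box.2 ⟨j + pos (k * e), ?_, elt (k * e), helt _, ?_⟩
    · have := abs_add_le j (pos (k * e))
      push_cast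
      zify at hle
      linarith
    · rw [zpow_add, mul_assoc, hpos, ← mul_assoc, ← hk, mul_assoc]
  rcases hE.conj k with h | h
  · exact key i rfl (h i)
  · exact key (-i) (abs_neg i) (h i)

theorem exists_boxQuot_subset :
    ∃ c : ℕ, ∀ N M : ℕ, boxQuot t E N M ⊆ box t E (N + M + c) := by
  classical
  obtain ⟨c, hc⟩ := hE.exists_mul_mem_box (E⁻¹)
  refine ⟨c, fun N M g hg => ?_⟩
  obtain ⟨a, ha, b, hb, rfl⟩ := Finset.mem_mul.1 hg
  obtain ⟨i, hi, e, he, h1⟩ := mem_box.1 (Finset.mem_inv'.1 ha)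
  obtain ⟨j, hj, f, hf, rfl⟩ := mem_box.1 hb
  have : a * (t ^ j * f) = e⁻¹ * (t ^ (j - i) * f) := by
    rw [← inv_inv a, ← h1]; group
  rw [this]
  refine hc (N + M) _ (Finset.inv_mem_inv he) _ (mem_box.2 ⟨j - i, ?_, f, hf, rfl⟩)
  have := abs_sub j i
  push_cast
  linarith

theorem eventually_isFolner_box (K : Finset G) {ε : ℝ} (hε : 0 < ε) :
    ∃ N₀ : ℕ, ∀ N ≥ N₀, IsFolner K (box t E N) ε := by
  obtain ⟨c, hc⟩ := hE.exists_mul_mem_box K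
  obtain ⟨N₀, hN₀⟩ := exists_nat_gt (2 * c / ε)
  refine ⟨N₀, fun N hN => ?_⟩
  let := Classical.decEq G
  change (((K * box t E N) \ box t E N).card : ℝ) < ε * (box t E N).card
  have h1 : (K * box t E N) \ box t E N ⊆ box t E (N + c) \ box t E N := by
    apply Finset.sdiff_subset_sdiff _ le_rfl
    intro g hg
    obtain ⟨k, hk, s, hs, rfl⟩ := Finset.mem_mul.1 hg
    exact hc N k hk s hs
  have h2 := Finset.card_le_card h1
  rw [Finset.card_sdiff_of_subset (box_mono (by omega)), hE.card_box, hE.card_box,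
    ← Nat.sub_mul] at h2
  have h3 : 2 * (N + c) + 1 - (2 * N + 1) = 2 * c := by omega
  rw [h3] at h2
  rw [hE.card_box]
  have h4 : (((K * box t E N) \ box t E N).card : ℝ) ≤ 2 * c * E.card := by exact_mod_cast h2
  have h5 : (0 : ℝ) < E.card := by exact_mod_cast hE.card_pos
  have h6 : (2 * c : ℝ) < ε * N := by
    rw [div_lt_iff₀ hε] at hN₀
    have : (N₀ : ℝ) ≤ N := by exact_mod_cast hN
    nlinarith
  push_cast
  nlinarith

theorem eventually_card_boxQuot_self :
    ∃ N₀ : ℕ, ∀ N ≥ N₀, ((boxQuot t E N N).card : ℝ) ≤ 3 * (box t E N).card := by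
  obtain ⟨c, hc⟩ := hE.exists_boxQuot_subset
  refine ⟨c, fun N hN => ?_⟩
  have h := Finset.card_le_card (hc N N)
  rw [hE.card_box] at h
  rw [hE.card_box]
  have : (2 * (N + N + c) + 1) * E.card ≤ 3 * ((2 * N + 1) * E.card) := by
    rw [← mul_assoc]
    exact Nat.mul_le_mul_right _ (by omega)
  exact_mod_cast h.trans this

open scoped Classical in
theorem eventually_card_boxQuot_sdiff (N : ℕ) {η : ℝ} (hη : 0 < η) :
    ∃ M₀ : ℕ, ∀ M ≥ M₀,
      ((boxQuot t E N M \ box t E M).card : ℝ) ≤ η * (box t E M).card := by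
  obtain ⟨c, hc⟩ := hE.exists_boxQuot_subset
  obtain ⟨M₀, hM₀⟩ := exists_nat_gt (2 * (N + c) / η)
  refine ⟨M₀, fun M hM => ?_⟩
  have h2 := Finset.card_le_card (Finset.sdiff_subset_sdiff (hc N M) (le_refl (box t E M)))
  rw [Finset.card_sdiff_of_subset (box_mono (by omega)), hE.card_box, hE.card_box,
    ← Nat.sub_mul] at h2
  have h3 : 2 * (N + M + c) + 1 - (2 * M + 1) = 2 * (N + c) := by omega
  rw [h3] at h2
  rw [hE.card_box]
  have h4 : ((boxQuot t E N M \ box t E M).card : ℝ) ≤ 2 * (N + c) * E.card := by exact_mod_cast h2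
  have h5 : (0 : ℝ) < E.card := by exact_mod_cast hE.card_pos
  have h6 : (2 * (N + c) : ℝ) < η * M := by
    rw [div_lt_iff₀ hη] at hM₀
    have : (M₀ : ℝ) ≤ M := by exact_mod_cast hM
    nlinarith
  push_cast
  nlinarith

theorem one_mem_boxQuot (N : ℕ) : (1 : G) ∈ boxQuot t E N N := by
  classical
  obtain ⟨e, he⟩ := hE.nonempty
  have : e ∈ box t E N := mem_box.2 ⟨0, by simp, e, he, by simp⟩
  exact Finset.mem_mul.2 ⟨e⁻¹, Finset.inv_mem_inv this, e, this, by simp⟩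

end IsZTransversal

end Slab

section Dynamics

variable {G : Type*} [Group G] {t : G} {E : Finset G}
variable {X : Type*} [MulAction G X]

/-- `ν` is a probability measure invariant under the single transformation `t`. -/
def IsInvariantProb [MeasurableSpace X] (t : G) (ν : Measure X) : Prop :=
  IsProbabilityMeasure ν ∧ Measure.map (fun x : X => t • x) ν = ν

theorem InvProb.isInvariantProb [TopologicalSpace X] [MeasurableSpace X] {μ : Measure X}
    (h : InvProb G X μ) (t : G) : IsInvariantProb t μ :=
  ⟨h.1, h.2 t⟩

section Measurable

variable [TopologicalSpace X] [MeasurableSpace X] [BorelSpace X] [ContinuousConstSMul G X]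

theorem InvProb.smulInvariantMeasure {μ : Measure X} (h : InvProb G X μ) :
    SMulInvariantMeasure G X μ :=
  ⟨fun g s hs => by
    conv_rhs => rw [← h.2 g]
    rw [Measure.map_apply (measurable_const_smul g) hs]⟩

theorem InvProb.measure_smul {μ : Measure X} (h : InvProb G X μ) (g : G) (s : Set X) :
    μ (g • s) = μ s :=
  have := h.smulInvariantMeasure
  MeasureTheory.measure_smul μ g s

theorem IsInvariantProb.map_zpow {ν : Measure X} (h : IsInvariantProb t ν) (i : ℤ) :
    Measure.map (fun x : X => t ^ i • x) ν = ν := by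
  have hn : ∀ n : ℕ, Measure.map (fun x : X => t ^ n • x) ν = ν := by
    intro n
    induction n with
    | zero => simp
    | succ n ih =>
      have : (fun x : X => t ^ (n + 1) • x) = (fun x : X => t • x) ∘ fun x => t ^ n • x := by
        funext x; simp [pow_succ', mul_smul]
      rw [this, ← Measure.map_map (measurable_const_smul t) (measurable_const_smul _), ih, h.2]
  obtain ⟨n, rfl | rfl⟩ := i.eq_nat_or_neg
  · simpa using hn n
  · conv_lhs => rw [← hn n]
    rw [Measure.map_map (measurable_const_smul _) (measurable_const_smul _)]
    simp [Function.comp_def]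

theorem IsInvariantProb.measure_zpow_smul {ν : Measure X} (h : IsInvariantProb t ν) (i : ℤ)
    {s : Set X} (hs : MeasurableSet s) : ν (t ^ i • s) = ν s := by
  conv_rhs => rw [← h.map_zpow (-i)]
  rw [Measure.map_apply (measurable_const_smul _) hs, Set.preimage_smul]
  simp

/-- A measure invariant under `t` is dominated by a multiple of a `G`-invariant measure. -/
theorem IsZTransversal.exists_invProb (hE : IsZTransversal t E) {ν : Measure X}
    (h : IsInvariantProb t ν) : ∃ μ, InvProb G X μ ∧ ∀ s, ν s ≤ E.card * μ s := by
  classical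
  have := h.1
  have hd0 : (E.card : ENNReal) ≠ 0 := by exact_mod_cast hE.card_pos.ne'
  have hdt : (E.card : ENNReal) ≠ ⊤ := ENNReal.natCast_ne_top _
  set F : G → Measure X := fun e => Measure.map (fun x : X => e • x) ν with hF
  have hmul : ∀ g k, Measure.map (fun x : X => g • x) (F k) = F (g * k) := by
    intro g k
    rw [hF, Measure.map_map (measurable_const_smul g) (measurable_const_smul k)]
    simp [Function.comp_def, mul_smul]
  have hz : ∀ k (i : ℤ), F (k * t ^ i) = F k := by
    intro k i
    rw [← hmul]
    simp only [hF]
    rw [h.map_zpow]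
  choose pos elt helt hpos using hE.surj
  have hz' : ∀ k (i : ℤ), F (t ^ i * k) = F k := by
    intro k i
    rcases hE.conj k with hk | hk
    · rw [← hk, hz]
    · have := hk (-i)
      rw [neg_neg] at this
      rw [← this, hz]
  have hmap : ∀ g, ∑ e ∈ E, F (g * e) = ∑ e ∈ E, F e := by
    intro g
    have hinj : Set.InjOn (fun e => elt (g * e)) E := by
      intro e he f hf hef
      simp only at hef
      have h1 : g * e = t ^ (pos (g * e) - pos (g * f)) * (g * f) := by
        have h2 : elt (g * e) = t ^ (-pos (g * f)) * (g * f) := by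
          rw [hef, zpow_neg, eq_inv_mul_iff_mul_eq, hpos]
        rw [sub_eq_add_neg, zpow_add, mul_assoc, ← h2, hpos]
      have h2 : ∃ j : ℤ, e = t ^ j * f := by
        set i := pos (g * e) - pos (g * f)
        rcases hE.conj g with hg | hg
        · refine ⟨i, ?_⟩
          rw [← mul_assoc, ← hg, mul_assoc] at h1
          exact mul_left_cancel h1
        · refine ⟨-i, ?_⟩
          have := hg (-i)
          rw [neg_neg] at this
          rw [← mul_assoc, ← this, mul_assoc] at h1
          exact mul_left_cancel h1
      obtain ⟨j, hj⟩ := h2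
      exact (hE.inj 0 j e he f hf (by simpa using hj)).2
    refine Finset.sum_nbij (fun e => elt (g * e)) (fun e _ => helt _) hinj
      (Finset.surjOn_of_injOn_of_card_le _ (fun e _ => helt _) hinj le_rfl) ?_
    intro e _
    rw [← hpos (g * e), hz', hpos]
  refine ⟨(E.card : ENNReal)⁻¹ • ∑ e ∈ E, F e, ⟨⟨?_⟩, ?_⟩, ?_⟩
  · have : ∀ e, F e Set.univ = 1 := fun e => by
      rw [hF, Measure.map_apply (measurable_const_smul e) MeasurableSet.univ]; simp
    simp only [Measure.smul_apply, Measure.finsetSum_apply, this, smul_eq_mul]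
    simp [ENNReal.inv_mul_cancel hd0 hdt]
  · intro g
    rw [Measure.map_smul, ← Measure.mapₗ_apply_of_measurable (measurable_const_smul g), map_sum]
    simp only [Measure.mapₗ_apply_of_measurable (measurable_const_smul g), hmul, hmap]
  · intro s
    have h1 : ν = F (elt 1) := by
      have : elt 1 = 1 * t ^ (-pos 1) := by
        rw [one_mul, zpow_neg, eq_inv_iff_mul_eq_one]
        exact mul_eq_one_iff_eq_inv.2 (eq_inv_of_mul_eq_one_right (hpos 1))
      rw [this, hz]; simp [hF]
    rw [Measure.smul_apply, Measure.finsetSum_apply, smul_eq_mul, ← mul_assoc,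
      ENNReal.mul_inv_cancel hd0 hdt, one_mul]
    conv_lhs => rw [h1]
    exact Finset.single_le_sum (f := fun e => F e s) (fun _ _ => zero_le) (helt 1)

end Measurable

section Free

variable [MetricSpace X] [ContinuousConstSMul G X]

theorem IsZTransversal.iUnion_smul_closure (hE : IsZTransversal t E) (hmin : Minimal G X)
    (x : X) : ⋃ e ∈ E, e • closure (Set.range fun i : ℤ => t ^ i • x) = Set.univ := by
  have hcl : IsClosed (⋃ e ∈ E, e • closure (Set.range fun i : ℤ => t ^ i • x)) :=
    E.finite_toSet.isClosed_biUnion fun e _ => isClosed_closure.smul e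
  rw [← Set.univ_subset_iff, ← (hmin x).closure_eq]
  refine closure_minimal ?_ hcl
  rintro _ ⟨g, rfl⟩
  obtain ⟨i, e, he, rfl⟩ := hE.surj' g
  refine Set.mem_biUnion he ?_
  simp only [mul_smul]
  exact Set.smul_mem_smul_set (subset_closure ⟨i, rfl⟩)

theorem IsZTransversal.zpow_smul_ne [Infinite X] (hE : IsZTransversal t E) (hmin : Minimal G X)
    {j : ℤ} (hj : j ≠ 0) (x : X) : t ^ j • x ≠ x := by
  intro hx
  have hfin : (Set.range fun i : ℤ => t ^ i • x).Finite := by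
    refine ((Set.finite_Ico (0 : ℤ) |j|).image fun i : ℤ => t ^ i • x).subset ?_
    rintro _ ⟨i, rfl⟩
    refine ⟨i % j, ⟨Int.emod_nonneg _ hj, Int.emod_lt_abs _ hj⟩, ?_⟩
    have hk : ∀ k : ℤ, t ^ (j * k) • x = x := by
      intro k
      rw [zpow_mul]
      have : t ^ j ∈ MulAction.stabilizer G x := hx
      exact (MulAction.stabilizer G x).zpow_mem this k
    conv_rhs => rw [← Int.emod_add_mul_ediv i j]
    simp only [zpow_add, mul_smul, hk]
  have hall := hE.iUnion_smul_closure hmin x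
  rw [hfin.isClosed.closure_eq] at hall
  exact Set.infinite_univ (hall ▸ E.finite_toSet.biUnion fun e _ => hfin.smul_set)

/-- A minimal topologically free action of a virtually cyclic group is essentially free. -/
theorem IsZTransversal.essFree [CompactSpace X] [Infinite X] [MeasurableSpace X] [BorelSpace X]
    (hE : IsZTransversal t E)
    (hmin : Minimal G X) (htf : TopFree G X) : EssFree G X := by
  intro g hg μ hμ
  have hclosed : IsClosed {x : X | g • x = x} :=
    isClosed_eq (continuous_const_smul g) continuous_id
  rcases hE.conj g with h | h
  · convert measure_empty (μ := μ)
    by_contra hne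
    obtain ⟨x, hx⟩ := Set.nonempty_iff_ne_empty.2 hne
    have hsub : closure (Set.range fun i : ℤ => t ^ i • x) ⊆ {x : X | g • x = x} := by
      refine closure_minimal ?_ hclosed
      rintro _ ⟨i, rfl⟩
      simp only [Set.mem_ofPred_eq] at hx ⊢
      rw [← mul_smul, h, mul_smul, hx]
    have := htf g hg
    rw [hclosed.closure_eq] at this
    have hemp : interior (closure (Set.range fun i : ℤ => t ^ i • x)) = ∅ :=
      Set.subset_empty_iff.1 (this ▸ interior_mono hsub)
    have hne : Nonempty X := ⟨x⟩
    obtain ⟨e, he⟩ := nonempty_interior_of_iUnion_of_closed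
      (f := fun e : E => (e : G) • closure (Set.range fun i : ℤ => t ^ i • x))
      (fun e => isClosed_closure.smul _) (by
        rw [← hE.iUnion_smul_closure hmin x]; simp only [Set.iUnion_subtype])
    rw [interior_smul, hemp] at he
    simp at he
  · by_contra hne
    have hdisj : Pairwise (Function.onFun Disjoint fun i : ℤ => t ^ i • {x : X | g • x = x}) := by
      intro i j hij
      refine Set.disjoint_left.2 ?_
      rintro _ ⟨x, hx, rfl⟩ ⟨y, hy, hxy⟩
      simp only [Set.mem_ofPred_eq] at hx hy hxy
      have h1 : g • t ^ i • x = t ^ (-i) • x := by rw [← mul_smul, h, mul_smul, hx]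
      rw [← hxy, ← mul_smul, h, mul_smul, hy] at h1
      have h2 : y = t ^ (i - j) • x := by
        have := congrArg (fun z => t ^ (-j) • z) hxy
        simp only [← mul_smul, ← zpow_add] at this
        simpa [sub_eq_neg_add] using this
      rw [h2, ← mul_smul, ← zpow_add] at h1
      have h3 := congrArg (fun z => t ^ i • z) h1
      simp only [← mul_smul, ← zpow_add, add_neg_cancel, zpow_zero, one_smul] at h3
      exact hE.zpow_smul_ne hmin (by omega) x h3
    have := hμ.1
    have hfin := Measure.finite_const_le_meas_of_disjoint_iUnion μ (pos_iff_ne_zero.2 hne)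
      (fun i : ℤ => (hclosed.smul (t ^ i)).measurableSet) hdisj (measure_ne_top _ _)
    refine Set.infinite_univ (α := ℤ) (hfin.subset fun i _ => ?_)
    simp only [Set.mem_ofPred_eq]
    rw [hμ.measure_smul]

end Free
end Dynamics

section Compactness

variable {G : Type*} [Group G] {t : G}
variable {X : Type*} [MulAction G X] [MetricSpace X] [CompactSpace X]
  [MeasurableSpace X] [BorelSpace X] [ContinuousConstSMul G X]

open Filter Topology BoundedContinuousFunction

theorem integrable_of_continuous {ν : Measure X} [IsFiniteMeasure ν] {f : X → ℝ}
    (hf : Continuous f) : Integrable f ν :=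
  hf.integrable_of_hasCompactSupport (HasCompactSupport.of_compactSpace f)

/-- The uniform measure on an orbit segment. -/
noncomputable def empirical (t : G) (n : ℕ) (x : X) : Measure X :=
  ((n + 1 : ℕ) : ENNReal)⁻¹ • ∑ j ∈ Finset.range (n + 1), Measure.dirac (t ^ j • x)

instance (n : ℕ) (x : X) : IsProbabilityMeasure (empirical t n x) := by
  constructor
  have h : ((n + 1 : ℕ) : ENNReal) ≠ 0 := by simp
  simp only [empirical, Measure.smul_apply, Measure.finsetSum_apply, measure_univ, smul_eq_mul,
    Finset.sum_const, Finset.card_range, nsmul_eq_mul, mul_one]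
  exact ENNReal.inv_mul_cancel h (ENNReal.natCast_ne_top _)

omit [CompactSpace X] [ContinuousConstSMul G X] in
theorem integral_empirical (n : ℕ) (x : X) (f : X → ℝ) :
    ∫ y, f y ∂empirical t n x = (n + 1 : ℝ)⁻¹ * ∑ j ∈ Finset.range (n + 1), f (t ^ j • x) := by
  rw [empirical, integral_smul_measure, integral_finsetSum_measure]
  · have : ((n : ENNReal) + 1).toReal = n + 1 := by
      rw [ENNReal.toReal_add (ENNReal.natCast_ne_top _) ENNReal.one_ne_top]; simp
    simp [integral_dirac, this]
  · intro i _
    exact integrable_dirac (by simp)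

/-- If every `t`-invariant measure makes some member of a decreasing sequence of continuous
functions negative, then the Birkhoff sums of some member are eventually negative, uniformly. -/
theorem exists_sum_neg (F : ℕ → X → ℝ) (hF : ∀ k, Continuous (F k)) (hanti : Antitone F)
    (hneg : ∀ ν : Measure X, IsInvariantProb t ν → ∃ k, ∫ x, F k x ∂ν < 0) :
    ∃ k n₀ : ℕ, ∀ n ≥ n₀, ∀ x, ∑ j ∈ Finset.range n, F k (t ^ j • x) < 0 := by
  by_contra! hcon
  have hcon' : ∀ k : ℕ, ∃ n ≥ k, ∃ x, 0 ≤ ∑ j ∈ Finset.range (n + 1), F k (t ^ j • x) := by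
    intro k
    obtain ⟨n, hn, x, hx⟩ := hcon k (k + 1)
    obtain ⟨n, rfl⟩ : ∃ m, n = m + 1 := ⟨n - 1, by omega⟩
    exact ⟨n, by omega, x, hx⟩
  choose n hn x hx using hcon'
  let P : ℕ → ProbabilityMeasure X := fun k => ⟨empirical t (n k) (x k), inferInstance⟩
  let U : Ultrafilter (ProbabilityMeasure X) := (hyperfilter ℕ).map P
  let ν : ProbabilityMeasure X := @Ultrafilter.lim _ _ U
  have hlim : Tendsto P (hyperfilter ℕ) (𝓝 ν) := Ultrafilter.le_nhds_lim U
  rw [ProbabilityMeasure.tendsto_iff_forall_integral_tendsto] at hlim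
  have hle : ((hyperfilter ℕ : Ultrafilter ℕ) : Filter ℕ) ≤ atTop := by
    rw [← Nat.cofinite_eq_atTop]; exact hyperfilter_le_cofinite
  have hP : ∀ k (f : X → ℝ), ∫ y, f y ∂(P k : Measure X) =
      (n k + 1 : ℝ)⁻¹ * ∑ j ∈ Finset.range (n k + 1), f (t ^ j • x k) :=
    fun k f => integral_empirical _ _ _
  have hinv : IsInvariantProb t (ν : Measure X) := by
    refine ⟨inferInstance, ?_⟩
    have hmeas : Measurable fun x : X => t • x := measurable_const_smul t
    have := Measure.isProbabilityMeasure_map (μ := (ν : Measure X)) hmeas.aemeasurable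
    refine ext_of_forall_integral_eq_of_IsFiniteMeasure fun f => ?_
    rw [integral_map hmeas.aemeasurable f.continuous.aestronglyMeasurable]
    let g : X →ᵇ ℝ := f.compContinuous ⟨fun x => t • x, continuous_const_smul t⟩
    have h1 := (hlim g).sub (hlim f)
    have h2 : Tendsto (fun k => ∫ ω, g ω ∂(P k : Measure X) - ∫ ω, f ω ∂(P k : Measure X))
        (hyperfilter ℕ) (𝓝 0) := by
      refine Tendsto.mono_left ?_ hle
      have h3 : Tendsto (fun k : ℕ => ((k : ℝ) + 1)⁻¹ * (2 * ‖f‖)) atTop (𝓝 0) := by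
        have := (tendsto_one_div_add_atTop_nhds_zero_nat (𝕜 := ℝ)).mul_const (2 * ‖f‖)
        simpa using this
      refine squeeze_zero_norm (fun k => ?_) h3
      rw [hP, hP, ← mul_sub, ← Finset.sum_sub_distrib]
      have h4 : ∑ j ∈ Finset.range (n k + 1), (g (t ^ j • x k) - f (t ^ j • x k)) =
          f (t ^ (n k + 1) • x k) - f (t ^ 0 • x k) := by
        rw [← Finset.sum_range_sub fun j => f (t ^ j • x k)]
        refine Finset.sum_congr rfl fun j _ => ?_
        change f (t • t ^ j • x k) - _ = _
        rw [← mul_smul, ← pow_succ']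
      rw [h4, norm_mul, norm_inv]
      have h5 : ‖f (t ^ (n k + 1) • x k) - f (t ^ 0 • x k)‖ ≤ 2 * ‖f‖ := by
        refine (norm_sub_le _ _).trans ?_
        have := f.norm_coe_le_norm (t ^ (n k + 1) • x k)
        have := f.norm_coe_le_norm (t ^ 0 • x k)
        linarith
      refine mul_le_mul (inv_anti₀ (by positivity) ?_) h5 (norm_nonneg _) (by positivity)
      rw [Real.norm_of_nonneg (by positivity)]
      have : (k : ℝ) ≤ n k := by exact_mod_cast hn k
      linarith
    exact sub_eq_zero.1 (tendsto_nhds_unique h1 h2)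
  obtain ⟨l, hl⟩ := hneg ν hinv
  refine absurd ?_ (not_le.2 hl)
  let f : X →ᵇ ℝ := BoundedContinuousFunction.mkOfCompact ⟨F l, hF l⟩
  refine ge_of_tendsto (hlim f) ?_
  refine hle ?_
  filter_upwards [eventually_ge_atTop l] with k hk
  rw [hP]
  refine mul_nonneg (by positivity) ((hx k).trans (Finset.sum_le_sum fun j _ => hanti hk _))

theorem sum_integral_smul {ν : Measure X} (h : IsInvariantProb t ν) {f : X → ℝ}
    (hf : Continuous f) (n : ℕ) :
    ∫ x, ∑ j ∈ Finset.range n, f (t ^ j • x) ∂ν = n * ∫ x, f x ∂ν := by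
  have := h.1
  have hint : ∀ j ∈ Finset.range n, Integrable (fun x => f (t ^ j • x)) ν := fun j _ =>
    integrable_of_continuous (hf.comp (continuous_const_smul (t ^ j)))
  rw [integral_finsetSum _ hint]
  have : ∀ j : ℕ, ∫ x, f (t ^ j • x) ∂ν = ∫ x, f x ∂ν := by
    intro j
    have h1 := h.map_zpow (j : ℤ)
    simp only [zpow_natCast] at h1
    conv_rhs => rw [← h1]
    rw [integral_map (measurable_const_smul _).aemeasurable hf.aestronglyMeasurable]
  simp [this]

/-- Continuous functions decreasing to the indicator of a closed set. -/
noncomputable def approxIndicator (A : Set X) (k : ℕ) (x : X) : ℝ :=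
  thickenedIndicator (δ := (1 : ℝ) / (k + 1)) Nat.one_div_pos_of_nat A x

omit [CompactSpace X] [MeasurableSpace X] [BorelSpace X] in
theorem continuous_approxIndicator (A : Set X) (k : ℕ) : Continuous (approxIndicator A k) :=
  NNReal.continuous_coe.comp (thickenedIndicator _ A).continuous

omit [CompactSpace X] [MeasurableSpace X] [BorelSpace X] in
theorem approxIndicator_nonneg (A : Set X) (k : ℕ) (x : X) : 0 ≤ approxIndicator A k x :=
  NNReal.coe_nonneg _

omit [CompactSpace X] [MeasurableSpace X] [BorelSpace X] in
theorem approxIndicator_of_mem {A : Set X} (k : ℕ) {x : X} (hx : x ∈ A) :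
    approxIndicator A k x = 1 := by
  rw [approxIndicator, thickenedIndicator_one _ A hx, NNReal.coe_one]

omit [CompactSpace X] [MeasurableSpace X] [BorelSpace X] in
theorem antitone_approxIndicator (A : Set X) : Antitone (approxIndicator A) := by
  intro k l hkl x
  refine NNReal.coe_le_coe.2 (thickenedIndicator_mono _ _ ?_ A x)
  exact one_div_le_one_div_of_le (by positivity) (by gcongr)

omit [CompactSpace X] in
theorem tendsto_integral_approxIndicator {A : Set X} (hA : IsClosed A) (ν : Measure X)
    [IsFiniteMeasure ν] :
    Tendsto (fun k => ∫ x, approxIndicator A k x ∂ν) atTop (𝓝 (ν.real A)) :=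
  tendsto_integral_thickenedIndicator_of_isClosed ν hA (fun _ => Nat.one_div_pos_of_nat)
    tendsto_one_div_add_atTop_nhds_zero_nat

/-- A closed set null for all invariant measures has neighbourhoods of uniformly small measure. -/
theorem IsZTransversal.exists_isOpen_measure_le {E : Finset G} (hE : IsZTransversal t E)
    {A : Set X} (hA : IsClosed A) (h0 : ∀ μ : Measure X, InvProb G X μ → μ A = 0)
    {η : ℝ} (hη : 0 < η) :
    ∃ O : Set X, IsOpen O ∧ A ⊆ O ∧ ∀ μ : Measure X, InvProb G X μ → μ.real O ≤ η := by
  obtain ⟨k, n₀, hk⟩ := exists_sum_neg (t := t) (fun k x => approxIndicator A k x - η / 2)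
    (fun k => (continuous_approxIndicator A k).sub continuous_const)
    (fun k l hkl x => sub_le_sub_right (antitone_approxIndicator A hkl x) _) (by
      intro ν hν
      have := hν.1
      obtain ⟨μ, hμ, hle⟩ := hE.exists_invProb hν
      have hνA : ν A = 0 := by
        have := hle A
        rw [h0 μ hμ, mul_zero] at this
        exact nonpos_iff_eq_zero.1 this
      have h1 := tendsto_integral_approxIndicator hA ν
      rw [measureReal_def, hνA, ENNReal.toReal_zero] at h1
      obtain ⟨k, hk⟩ := (h1.eventually_lt_const (half_pos hη)).exists
      refine ⟨k, ?_⟩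
      rw [integral_sub (integrable_of_continuous (continuous_approxIndicator A k))
        (integrable_const _)]
      simpa using hk)
  refine ⟨{x | 1 / 2 < approxIndicator A k x},
    isOpen_lt continuous_const (continuous_approxIndicator A k), fun x hx => ?_, fun μ hμ => ?_⟩
  · rw [Set.mem_ofPred_eq, approxIndicator_of_mem k hx]; norm_num
  · have := hμ.1
    have h1 : ∫ x, approxIndicator A k x ∂μ ≤ η / 2 := by
      have h2 := sum_integral_smul (hμ.isInvariantProb t)
        (f := fun x => approxIndicator A k x - η / 2)
        ((continuous_approxIndicator A k).sub continuous_const) (n₀ + 1)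
      have h3 : ∫ x, ∑ j ∈ Finset.range (n₀ + 1),
          (approxIndicator A k (t ^ j • x) - η / 2) ∂μ ≤ 0 :=
        integral_nonpos fun x => (hk (n₀ + 1) (by omega) x).le
      rw [h2, integral_sub (integrable_of_continuous (continuous_approxIndicator A k))
        (integrable_const _)] at h3
      have h4 := nonpos_of_mul_nonpos_right h3 (by positivity)
      simpa using h4
    have h5 := mul_meas_ge_le_integral_of_nonneg (μ := μ)
      (Eventually.of_forall (approxIndicator_nonneg A k))
      (integrable_of_continuous (continuous_approxIndicator A k)) (1 / 2)
    have h6 : μ.real {x | 1 / 2 < approxIndicator A k x} ≤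
        μ.real {x | 1 / 2 ≤ approxIndicator A k x} :=
      measureReal_mono (Set.ofPred_subset_ofPred.2 fun x hx => le_of_lt hx)
    linarith

end Compactness

section Subordination

variable {G : Type*} [Group G] {X : Type*} [TopologicalSpace X] [MulAction G X]

theorem Subord.of_finite {ι : Type*} [Finite ι] {C O : Set X} (V : ι → Set X) (g : ι → G)
    (hV : ∀ k, IsOpen (V k)) (hC : C ⊆ ⋃ k, V k) (hO : ∀ k, g k • V k ⊆ O)
    (hd : Pairwise fun k l => Disjoint (g k • V k) (g l • V l)) : Subord G X C O := by
  obtain ⟨n, ⟨e⟩⟩ := Finite.exists_equiv_fin ι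
  refine ⟨n, V ∘ e.symm, g ∘ e.symm, fun k => hV _, ?_, fun k => hO _, ?_⟩
  · exact hC.trans (e.symm.surjective.iUnion_comp V).ge
  · exact fun k l hkl => hd (e.symm.injective.ne hkl)

theorem Subord.mono {C C' O O' : Set X} (h : Subord G X C O) (hC : C' ⊆ C) (hO : O ⊆ O') :
    Subord G X C' O' := by
  obtain ⟨n, V, g, h1, h2, h3, h4⟩ := h
  exact ⟨n, V, g, h1, hC.trans h2, fun k => (h3 k).trans hO, h4⟩

theorem Subord.union {C C' O O' : Set X} (h : Subord G X C O) (h' : Subord G X C' O')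
    (hd : Disjoint O O') : Subord G X (C ∪ C') (O ∪ O') := by
  obtain ⟨n, V, g, h1, h2, h3, h4⟩ := h
  obtain ⟨n', V', g', h1', h2', h3', h4'⟩ := h'
  refine Subord.of_finite (ι := Fin n ⊕ Fin n') (Sum.elim V V') (Sum.elim g g') ?_ ?_ ?_ ?_
  · rintro (k | k)
    · exact h1 k
    · exact h1' k
  · rw [Set.iUnion_sum]
    exact Set.union_subset_union h2 h2'
  · rintro (k | k)
    · exact (h3 k).trans Set.subset_union_left
    · exact (h3' k).trans Set.subset_union_right
  · rintro (k | k) (l | l) hkl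
    · exact h4 (by simpa using hkl)
    · exact hd.mono (h3 k) (h3' l)
    · exact (hd.mono (h3 l) (h3' k)).symm
    · exact h4' (by simpa using hkl)

variable [ContinuousConstSMul G X]

theorem subord_inter_tower {t : G} {Y : Set X} (hY : IsOpen Y) {h : ℕ}
    (hdisj : ∀ i < h, ∀ j < h, i ≠ j → Disjoint (t ^ i • Y) (t ^ j • Y))
    {A B : Set X} {f φ : X → ℝ} (hf : Continuous f) (hφ : Continuous φ)
    (hf0 : ∀ x, 0 ≤ f x) (hφ1 : ∀ x, φ x ≤ 1)
    (hA : ∀ x ∈ A, f x = 1) (hB : ∀ x, 0 < φ x → x ∈ B)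
    (hlt : ∀ x, 4 * ∑ j ∈ Finset.range h, f (t ^ j • x) <
      ∑ j ∈ Finset.range h, φ (t ^ j • x)) :
    Subord G X (A ∩ ⋃ j ∈ Finset.range h, t ^ j • Y) B := by
  set S : ℕ → X → ℝ := fun n x => ∑ j ∈ Finset.range n, f (t ^ j • x) with hS
  set Φ : ℕ → X → ℝ := fun n x => ∑ j ∈ Finset.range n, φ (t ^ j • x) with hΦ
  have hSc : ∀ n, Continuous (S n) := fun n =>
    continuous_finsetSum _ fun j _ => hf.comp (continuous_const_smul (t ^ j))
  have hΦc : ∀ n, Continuous (Φ n) := fun n =>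
    continuous_finsetSum _ fun j _ => hφ.comp (continuous_const_smul (t ^ j))
  have hSmono : ∀ x, Monotone fun n => S n x := fun x => monotone_nat_of_le_succ fun n => by
    simp only [hS, Finset.sum_range_succ]
    linarith [hf0 (t ^ n • x)]
  set W : ℕ → ℕ → Set X := fun i i' => {y | y ∈ Y ∧ 9 / 10 < f (t ^ i • y) ∧
    0 < φ (t ^ i' • y) ∧ |Φ i' y - 4 * S i y| < 4 / 3} with hW
  have hWo : ∀ i i', IsOpen (W i i') := by
    intro i i'
    refine hY.inter ((isOpen_lt continuous_const (hf.comp (continuous_const_smul _))).inter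
      ((isOpen_lt continuous_const (hφ.comp (continuous_const_smul _))).inter
      (isOpen_lt (((hΦc i').sub (continuous_const.mul (hSc i))).abs) continuous_const)))
  have hgV : ∀ p : Fin h × Fin h, (t ^ (p.2 : ℕ) * (t ^ (p.1 : ℕ))⁻¹) • t ^ (p.1 : ℕ) • W p.1 p.2 =
      t ^ (p.2 : ℕ) • W p.1 p.2 := fun p => by
    rw [mul_smul, inv_smul_smul]
  refine Subord.of_finite (ι := Fin h × Fin h) (fun p => t ^ (p.1 : ℕ) • W p.1 p.2)
    (fun p => t ^ (p.2 : ℕ) * (t ^ (p.1 : ℕ))⁻¹) (fun p => (hWo _ _).smul _) ?_ ?_ ?_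
  · rintro z ⟨hzA, hz⟩
    simp only [Set.mem_iUnion, Finset.mem_range] at hz
    obtain ⟨i, hi, y, hy, rfl⟩ := hz
    have hex : ∃ n, 4 * S i y < Φ n y :=
      ⟨h, lt_of_le_of_lt (by linarith [hSmono y hi.le]) (hlt y)⟩
    classical
    set n := Nat.find hex with hn
    have hn1 : 4 * S i y < Φ n y := Nat.find_spec hex
    have hnh : n ≤ h := Nat.find_min' hex (lt_of_le_of_lt (by linarith [hSmono y hi.le]) (hlt y))
    have hS0 : 0 ≤ S i y := Finset.sum_nonneg fun j _ => hf0 _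
    have hn0 : n ≠ 0 := by
      intro h0
      rw [h0] at hn1
      simp only [hΦ, Finset.range_zero, Finset.sum_empty] at hn1
      linarith
    obtain ⟨m, hm⟩ := Nat.exists_eq_succ_of_ne_zero hn0
    have hm1 : Φ m y ≤ 4 * S i y := not_lt.1 (Nat.find_min hex (by omega : m < n))
    have hm2 : Φ n y = Φ m y + φ (t ^ m • y) := by
      rw [hm]; simp only [hΦ, Nat.succ_eq_add_one, Finset.sum_range_succ]
    refine Set.mem_iUnion.2 ⟨(⟨i, hi⟩, ⟨m, by omega⟩), Set.smul_mem_smul_set ⟨hy, ?_, ?_, ?_⟩⟩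
    · simp only
      rw [hA _ hzA]; norm_num
    · simp only; linarith
    · simp only
      rw [abs_lt]
      have := hφ1 (t ^ m • y)
      constructor <;> linarith
  · rintro p
    rw [hgV]
    rintro _ ⟨y, hy, rfl⟩
    exact hB _ hy.2.2.1
  · rintro ⟨i, i'⟩ ⟨j, j'⟩ hne
    simp only
    rw [hgV (i, i'), hgV (j, j')]
    by_cases hij : i' = j'
    · subst hij
      have hne' : (i : ℕ) ≠ j := fun h => hne (by rw [Fin.ext h])
      refine Set.disjoint_smul_set.2 (Set.disjoint_left.2 fun y hy hy' => ?_)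
      have key : ∀ a b : ℕ, a < b → 9 / 10 < f (t ^ a • y) → 9 / 10 ≤ S b y - S a y := by
        intro a b hab ha
        have h1 : S (a + 1) y ≤ S b y := hSmono y hab
        simp only [hS, Finset.sum_range_succ] at h1 ⊢
        linarith
      have h1 := abs_lt.1 hy.2.2.2
      have h2 := abs_lt.1 hy'.2.2.2
      rcases lt_or_gt_of_ne hne' with h | h
      · have := key _ _ h hy.2.1
        linarith
      · have := key _ _ h hy'.2.1
        linarith
    · refine (hdisj _ i'.2 _ j'.2 (fun h => hij (Fin.ext h))).mono ?_ ?_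
      · exact Set.smul_set_mono fun y hy => hy.1
      · exact Set.smul_set_mono fun y hy => hy.1

end Subordination

section Towers

variable {G : Type*} [Group G] {t : G} {E : Finset G}
variable {X : Type*} [MulAction G X] [MetricSpace X] [ContinuousConstSMul G X]

theorem exists_isOpen_disjoint_smul {S : Finset G} {x : X}
    (hx : ∀ g ∈ S, ∀ h ∈ S, g ≠ h → g • x ≠ h • x) :
    ∃ W : Set X, IsOpen W ∧ x ∈ W ∧ ∀ g ∈ S, ∀ h ∈ S, g ≠ h → Disjoint (g • W) (h • W) := by
  obtain ⟨U, hU, hd⟩ := (S.finite_toSet.image fun g => g • x).t2_separation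
  refine ⟨⋂ g ∈ S, g⁻¹ • U (g • x), isOpen_biInter_finset fun g _ => (hU _).2.smul _, ?_, ?_⟩
  · simp only [Set.mem_iInter, Set.mem_inv_smul_set_iff]
    exact fun g _ => (hU _).1
  · intro g hg h hh hne
    have hsub : ∀ g ∈ S, g • ⋂ g ∈ S, g⁻¹ • U (g • x) ⊆ U (g • x) := by
      rintro g hg _ ⟨y, hy, rfl⟩
      simp only [Set.mem_iInter, Set.mem_inv_smul_set_iff] at hy
      exact hy g hg
    exact (hd ⟨g, hg, rfl⟩ ⟨h, hh, rfl⟩ (hx g hg h hh hne)).mono (hsub g hg) (hsub h hh)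

theorem TopFree.exists_smul_ne [CompactSpace X] [Nonempty X] (htf : TopFree G X)
    (S : Finset G) :
    ∃ x : X, ∀ g ∈ S, ∀ h ∈ S, g ≠ h → g • x ≠ h • x := by
  classical
  by_contra! hcon
  have hcl : ∀ g : G, IsClosed {x : X | g • x = x} := fun g =>
    isClosed_eq (continuous_const_smul g) continuous_id
  obtain ⟨k, hk⟩ := nonempty_interior_of_iUnion_of_closed
    (f := fun k : {k // k ∈ (S⁻¹ * S).erase 1} => {x : X | (k : G) • x = x})
    (fun k => hcl k) (by
      refine Set.eq_univ_of_forall fun x => ?_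
      obtain ⟨g, hg, h, hh, hne, heq⟩ := hcon x
      refine Set.mem_iUnion.2 ⟨⟨g⁻¹ * h, Finset.mem_erase.2 ⟨?_, ?_⟩⟩, ?_⟩
      · exact fun h1 => hne (inv_mul_eq_one.1 h1)
      · exact Finset.mul_mem_mul (Finset.inv_mem_inv hg) hh
      · rw [Set.mem_ofPred_eq, mul_smul, ← heq, inv_smul_smul])
  have := htf k (Finset.ne_of_mem_erase k.2)
  rw [(hcl _).closure_eq] at this
  rw [this] at hk
  exact Set.not_nonempty_empty hk

theorem IsZTransversal.exists_forall_mem_iUnion_smul [CompactSpace X] (hE : IsZTransversal t E)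
    (hmin : Minimal G X) {W : Set X} (hW : IsOpen W) (hne : W.Nonempty) :
    ∃ L : ℕ, ∀ x : X, ∃ j ≤ L, t ^ (-(j : ℤ)) • x ∈ ⋃ e ∈ E, e • W := by
  have hM : IsOpen (⋃ e ∈ E, e • W) := isOpen_biUnion fun e _ => hW.smul e
  obtain ⟨s, hs⟩ := isCompact_univ.elim_finite_subcover
    (fun i : ℤ => t ^ i • ⋃ e ∈ E, e • W) (fun i => hM.smul _) (by
      intro x _
      obtain ⟨_, ⟨g, rfl⟩, hg⟩ := (hmin x).exists_mem_open hW hne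
      obtain ⟨i, e, he, hie⟩ := hE.surj g⁻¹
      refine Set.mem_iUnion.2 ⟨i, ?_⟩
      rw [Set.mem_smul_set_iff_inv_smul_mem]
      refine Set.mem_biUnion he ?_
      rw [Set.mem_smul_set_iff_inv_smul_mem, ← mul_smul, ← mul_inv_rev, hie, inv_inv]
      exact hg)
  have hbd : ∀ i ∈ s, i.natAbs ≤ ∑ i ∈ s, i.natAbs := fun i hi =>
    Finset.single_le_sum (f := Int.natAbs) (fun _ _ => Nat.zero_le _) hi
  set L := ∑ i ∈ s, i.natAbs with hL
  refine ⟨2 * L, fun x => ?_⟩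
  obtain ⟨i, hi, hx⟩ := Set.mem_iUnion₂.1 (hs (Set.mem_univ (t ^ (-(L : ℤ)) • x)))
  have := hbd i hi
  refine ⟨(i + L).toNat, by omega, ?_⟩
  rw [Set.mem_smul_set_iff_inv_smul_mem, ← mul_smul, ← zpow_neg, ← zpow_add] at hx
  rwa [Int.toNat_of_nonneg (by omega), neg_add]

/-- Outside of a small closed set of markers there is a continuous cocycle-like function which
increases by one along `t`. -/
theorem exists_continuous_smul_eq_add_one {K M : Set X} (ψ : X → ℝ) (hψ : Continuous ψ)
    (hK : ∀ x ∉ K, ψ x = 0) (hM : ∀ x ∈ M, ψ x = 1)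
    (hL : ∃ L : ℕ, ∀ x : X, ∃ j ≤ L, t ^ (-(j : ℤ)) • x ∈ M) :
    ∃ D : X → ℝ, Continuous D ∧ ∀ x, t • x ∉ K → D (t • x) = D x + 1 := by
  obtain ⟨L, hL⟩ := hL
  set P : ℕ → X → ℝ := fun j x => ∏ i ∈ Finset.range j, (1 - ψ (t ^ (-(i : ℤ)) • x)) with hP
  refine ⟨fun x => ∑ j ∈ Finset.range (L + 1), P (j + 1) x, ?_, fun x hx => ?_⟩
  · refine continuous_finsetSum _ fun j _ => continuous_finsetProd _ fun i _ => ?_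
    exact continuous_const.sub (hψ.comp (continuous_const_smul _))
  · have hstep : ∀ j, P (j + 1) (t • x) = P j x := by
      intro j
      simp only [hP]
      rw [Finset.prod_range_succ']
      simp only [Nat.cast_zero, neg_zero, zpow_zero, one_smul, hK _ hx, sub_zero, mul_one]
      refine Finset.prod_congr rfl fun i _ => ?_
      congr 2
      rw [← mul_smul, ← zpow_add_one]
      congr 2
      push_cast
      ring
    have hlast : P (L + 1) x = 0 := by
      obtain ⟨j, hj, hx⟩ := hL x
      refine Finset.prod_eq_zero (Finset.mem_range.2 (Nat.lt_succ_of_le hj)) ?_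
      rw [hM _ hx, sub_self]
    simp only [hstep]
    rw [Finset.sum_range_succ', Finset.sum_range_succ (fun j => P (j + 1) x), hlast]
    simp [hP]

omit [MetricSpace X] [ContinuousConstSMul G X] in
theorem disjoint_pow_smul_of_smul_eq_add_one {K : Set X} {D : X → ℝ}
    (hD : ∀ x, t • x ∉ K → D (t • x) = D x + 1) (n : ℕ) (θ : ℝ) {Y : Set X}
    (hY : ∀ x ∈ Y, ∃ k : ℤ, ⌊D x - θ⌋ = k * n)
    (hYK : ∀ x ∈ Y, ∀ j ∈ Finset.Ico 1 n, t ^ j • x ∉ K) :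
    ∀ i < n, ∀ j < n, i ≠ j → Disjoint (t ^ i • Y) (t ^ j • Y) := by
  have hval : ∀ y ∈ Y, ∀ i < n, D (t ^ i • y) = D y + i := by
    intro y hy i
    induction i with
    | zero => simp
    | succ i ih =>
      intro hi
      rw [pow_succ', mul_smul, hD, ih (by omega)]
      · push_cast; ring
      · rw [← mul_smul, ← pow_succ']
        exact hYK y hy _ (Finset.mem_Ico.2 ⟨by omega, hi⟩)
  intro i hi j hj hne
  refine Set.disjoint_left.2 ?_
  rintro _ ⟨y, hy, rfl⟩ ⟨z, hz, hzy⟩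
  simp only at hzy
  have h1 := hval y hy i hi
  rw [← hzy, hval z hz j hj] at h1
  obtain ⟨k, hk⟩ := hY y hy
  obtain ⟨l, hl⟩ := hY z hz
  have h2 : ⌊D z - θ⌋ + (j : ℤ) = ⌊D y - θ⌋ + (i : ℤ) := by
    rw [← Int.floor_add_natCast, ← Int.floor_add_natCast]
    congr 1
    linarith
  rw [hk, hl] at h2
  have h3 := congrArg (· % (n : ℤ)) h2
  simp only [Int.add_comm _ (j : ℤ), Int.add_comm _ (i : ℤ),
    Int.add_mul_emod_self_right] at h3
  rw [Int.emod_eq_of_lt (by omega) (by omega), Int.emod_eq_of_lt (by omega) (by omega)] at h3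
  omega

/-- The phase space is covered by three arbitrarily tall open towers for `t`. -/
theorem IsZTransversal.exists_towers [CompactSpace X] [Nonempty X] (hE : IsZTransversal t E)
    (hmin : Minimal G X) (htf : TopFree G X) {n : ℕ} (hn : 0 < n) :
    ∃ (Y : Fin 3 → Set X) (h : Fin 3 → ℕ), (∀ c, IsOpen (Y c)) ∧ (∀ c, n ≤ h c) ∧
      (∀ c, ∀ i < h c, ∀ j < h c, i ≠ j → Disjoint (t ^ i • Y c) (t ^ j • Y c)) ∧
      ⋃ c, ⋃ j ∈ Finset.range (h c), t ^ j • Y c = Set.univ := by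
  obtain ⟨x₀, hx₀⟩ := htf.exists_smul_ne (box t E (2 * n))
  obtain ⟨W, hWo, hxW, hWd⟩ := exists_isOpen_disjoint_smul hx₀
  obtain ⟨r, hr, hrW⟩ := Metric.nhds_basis_closedBall.mem_iff.1 (hWo.mem_nhds hxW)
  set K : Set X := ⋃ e ∈ E, e • Metric.closedBall x₀ r with hK
  set U : Set X := ⋃ e ∈ E, e • Metric.ball x₀ r with hU
  set K₁ : Set X := ⋃ e ∈ E, e • Metric.closedBall x₀ (r / 2) with hK₁
  set M : Set X := ⋃ e ∈ E, e • W with hM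
  have hKc : IsClosed K := E.finite_toSet.isClosed_biUnion fun e _ =>
    Metric.isClosed_closedBall.smul e
  have hK₁c : IsClosed K₁ :=
    E.finite_toSet.isClosed_biUnion fun e _ =>
    Metric.isClosed_closedBall.smul e
  have hUo : IsOpen U := isOpen_biUnion fun e _ => Metric.isOpen_ball.smul e
  have hMo : IsOpen M := isOpen_biUnion fun e _ => hWo.smul e
  have hKM : K ⊆ M := Set.iUnion₂_mono fun e _ => Set.smul_set_mono hrW
  have hUK : U ⊆ K := Set.iUnion₂_mono fun e _ => Set.smul_set_mono Metric.ball_subset_closedBall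
  have hK₁U : K₁ ⊆ U := Set.iUnion₂_mono fun e _ =>
    Set.smul_set_mono (Metric.closedBall_subset_ball (by linarith))
  obtain ⟨ψ, hψ0, hψ1, -⟩ := exists_continuous_zero_one_of_isClosed hUo.isClosed_compl hK₁c
    (Set.disjoint_left.2 fun x hx hx' => hx (hK₁U hx'))
  obtain ⟨D, hDc, hD⟩ := exists_continuous_smul_eq_add_one (t := t) (K := K) (M := K₁) ψ
    ψ.continuous (fun x hx => hψ0 fun h => hx (hUK h)) (fun x hx => hψ1 hx) (by
      obtain ⟨L, hL⟩ := hE.exists_forall_mem_iUnion_smul hmin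
        (Metric.isOpen_ball (x := x₀) (ε := r / 2)) ⟨x₀, Metric.mem_ball_self (by linarith)⟩
      refine ⟨L, fun x => ?_⟩
      obtain ⟨j, hj, hjx⟩ := hL x
      exact ⟨j, hj,
        Set.iUnion₂_mono (fun e _ => Set.smul_set_mono Metric.ball_subset_closedBall) hjx⟩)
  have hMd : ∀ j : ℤ, j ≠ 0 → |j| ≤ 2 * n → Disjoint (t ^ j • M) M := by
    intro j hj0 hj
    rw [hM, Set.smul_set_iUnion₂]
    simp only [Set.disjoint_iUnion_left, Set.disjoint_iUnion_right]
    intro e he f hf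
    rw [← mul_smul]
    refine hWd _ (mem_box.2 ⟨j, by exact_mod_cast hj, f, hf, rfl⟩) _
      (mem_box.2 ⟨0, by simp, e, he, by simp⟩) fun h => hj0 ?_
    exact (hE.inj j 0 f hf e he (by simpa using h)).1
  set Z : ℝ → Set X := fun θ => {x | (∃ k : ℤ, (k * n : ℤ) < D x - θ ∧ D x - θ < (k * n : ℤ) + 1) ∧
    ∀ j ∈ Finset.Ico 1 n, t ^ j • x ∉ K} with hZ
  have hZo : ∀ θ, IsOpen (Z θ) := by
    intro θ
    have hZeq : Z θ = (⋃ k : ℤ, {x | (k * n : ℤ) < D x - θ} ∩ {x | D x - θ < (k * n : ℤ) + 1}) ∩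
        ⋂ j ∈ Finset.Ico 1 n, (fun x => t ^ j • x) ⁻¹' Kᶜ := by
      ext x
      simp only [hZ, Set.mem_inter_iff, Set.mem_iUnion, Set.mem_iInter]
      rfl
    rw [hZeq]
    refine IsOpen.inter ?_ ?_
    · refine isOpen_iUnion fun k => IsOpen.inter ?_ ?_
      · exact isOpen_lt continuous_const (hDc.sub continuous_const)
      · exact isOpen_lt (hDc.sub continuous_const) continuous_const
    · exact isOpen_biInter_finset fun j _ => hKc.isOpen_compl.preimage (continuous_const_smul _)
  have hZd : ∀ θ, ∀ i < n, ∀ j < n, i ≠ j → Disjoint (t ^ i • Z θ) (t ^ j • Z θ) := by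
    intro θ
    refine disjoint_pow_smul_of_smul_eq_add_one hD n θ ?_ (fun x hx => hx.2)
    rintro x ⟨⟨k, hk1, hk2⟩, -⟩
    exact ⟨k, Int.floor_eq_iff.2 ⟨hk1.le, hk2⟩⟩
  have hZcover : ∀ θ z, (∀ j : ℤ, |j| < n → t ^ j • z ∉ K) → (∀ m : ℤ, D z - θ ≠ m) →
      z ∈ ⋃ j ∈ Finset.range n, t ^ j • Z θ := by
    intro θ z hz hm
    have hn' : (n : ℤ) ≠ 0 := by omega
    have hr0 := Int.emod_nonneg ⌊D z - θ⌋ hn'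
    have hrn := Int.emod_lt_of_pos ⌊D z - θ⌋ (by omega : (0 : ℤ) < n)
    have hdiv := Int.emod_add_mul_ediv ⌊D z - θ⌋ n
    obtain ⟨r, hr⟩ := Int.eq_ofNat_of_zero_le hr0
    have hfl : (⌊D z - θ⌋ : ℝ) < D z - θ := lt_of_le_of_ne (Int.floor_le _) (hm _).symm
    have hfl' := Int.lt_floor_add_one (D z - θ)
    set q := ⌊D z - θ⌋
    rw [hr] at hdiv hrn
    have hDr : ∀ i ≤ r, D (t ^ (-(i : ℤ)) • z) = D z - i := by
      intro i
      induction i with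
      | zero => simp
      | succ i ih =>
        intro hi
        have h1 : t • t ^ (-((i + 1 : ℕ) : ℤ)) • z = t ^ (-(i : ℤ)) • z := by
          rw [← mul_smul, ← zpow_one_add]; congr 2; push_cast; ring
        have h2 := hD (t ^ (-((i + 1 : ℕ) : ℤ)) • z) (by
          rw [h1]; exact hz _ (by rw [abs_neg, abs_of_nonneg] <;> omega))
        rw [h1, ih (by omega)] at h2
        push_cast at h2 ⊢
        linarith
    refine Set.mem_biUnion (Finset.mem_range.2 (by omega : r < n)) ?_
    rw [Set.mem_smul_set_iff_inv_smul_mem]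
    have heq : (t ^ r)⁻¹ • z = t ^ (-(r : ℤ)) • z := by rw [zpow_neg, zpow_natCast]
    rw [heq]
    refine ⟨⟨q / n, ?_⟩, fun j hj => ?_⟩
    · have h3 : q / n * n = q - r := by linarith
      rw [hDr r le_rfl, h3]
      push_cast
      constructor <;> linarith
    · rw [← zpow_natCast, ← mul_smul, ← zpow_add]
      have := Finset.mem_Ico.1 hj
      exact hz _ (by rw [abs_lt]; omega)
  refine ⟨![Z 0, Z (1 / 2), t ^ (-(n : ℤ)) • M], ![n, n, 2 * n], ?_, ?_, ?_, ?_⟩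
  · intro c
    fin_cases c
    · exact hZo 0
    · exact hZo _
    · exact hMo.smul _
  · intro c
    fin_cases c
    · exact le_rfl
    · exact le_rfl
    · exact Nat.le_mul_of_pos_left n two_pos
  · intro c
    fin_cases c
    · exact hZd 0
    · exact hZd _
    · intro i hi j hj hne
      have hi' : i < 2 * n := hi
      have hj' : j < 2 * n := hj
      change Disjoint (t ^ i • t ^ (-(n : ℤ)) • M) (t ^ j • t ^ (-(n : ℤ)) • M)
      have : ∀ k : ℕ, t ^ k • t ^ (-(n : ℤ)) • M = t ^ (-(n : ℤ)) • t ^ (k : ℤ) • M := by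
        intro k
        rw [← zpow_natCast, ← mul_smul, ← mul_smul, ← zpow_add, ← zpow_add, add_comm]
      have h2 : t ^ (i : ℤ) • M = t ^ (j : ℤ) • t ^ ((i : ℤ) - j) • M := by
        rw [← mul_smul, ← zpow_add]; congr 2; ring
      rw [this, this, Set.disjoint_smul_set, h2, Set.disjoint_smul_set]
      exact hMd _ (by omega) (by rw [abs_le]; omega)
  · refine Set.eq_univ_of_forall fun z => Set.mem_iUnion.2 ?_
    by_cases hz : ∀ j : ℤ, |j| < n → t ^ j • z ∉ K
    · by_cases hm : ∀ m : ℤ, D z - 0 ≠ m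
      · exact ⟨0, hZcover 0 z hz hm⟩
      · refine ⟨1, hZcover (1 / 2) z hz fun m hm' => hm fun l hl => ?_⟩
        have h1 : (2 * (l - m) : ℝ) = 1 := by linarith
        have h2 : 2 * (l - m) = 1 := by exact_mod_cast h1
        omega
    · push Not at hz
      obtain ⟨j, hj, hjz⟩ := hz
      rw [abs_lt] at hj
      refine ⟨2, Set.mem_biUnion (x := (n - j).toNat) (Finset.mem_range.2 ?_) ?_⟩
      · change _ < 2 * n
        omega
      · change z ∈ t ^ (n - j).toNat • t ^ (-(n : ℤ)) • M
        rw [← zpow_natCast, Int.toNat_of_nonneg (by omega), ← mul_smul, ← zpow_add,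
          Set.mem_smul_set_iff_inv_smul_mem, ← zpow_neg]
        have : -((n : ℤ) - j + -n) = j := by ring
        rw [this]
        exact hKM hjz

end Towers

section Comparison

variable {G : Type*} [Group G] {t : G} {E : Finset G}
variable {X : Type*} [MulAction G X] [MetricSpace X] [CompactSpace X] [Nonempty X]
  [MeasurableSpace X] [BorelSpace X] [ContinuousConstSMul G X]

open Filter Topology

/-- A closed set is subordinate to the union of three disjoint open sets, each of which has larger
measure by a definite factor for every measure invariant under `t`. -/
theorem IsZTransversal.subord_of_measure_lt (hE : IsZTransversal t E) (hmin : Minimal G X)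
    (htf : TopFree G X) {R : Set X} (hR : IsClosed R) {B : Fin 3 → Set X}
    (hB : ∀ c, IsOpen (B c)) (hBd : Pairwise fun c c' => Disjoint (B c) (B c'))
    (hlt : ∀ ν : Measure X, IsInvariantProb t ν → ∀ c, 4 * ν.real R < ν.real (B c)) :
    Subord G X R (⋃ c, B c) := by
  have key : ∀ c, ∃ k n₀ : ℕ, ∀ n ≥ n₀, ∀ x, ∑ j ∈ Finset.range n,
      (4 * approxIndicator R k (t ^ j • x) + approxIndicator (B c)ᶜ k (t ^ j • x) - 1) < 0 := by
    intro c
    refine exists_sum_neg (fun k x => 4 * approxIndicator R k x + approxIndicator (B c)ᶜ k x - 1)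
      (fun k => ?_) (fun k l hkl x => ?_) (fun ν hν => ?_)
    · have := continuous_approxIndicator R k
      have := continuous_approxIndicator (B c)ᶜ k
      fun_prop
    · have h1 := antitone_approxIndicator R hkl x
      have h2 := antitone_approxIndicator (B c)ᶜ hkl x
      simp only
      linarith
    · have := hν.1
      have h1 := ((tendsto_integral_approxIndicator hR ν).const_mul 4).add
        (tendsto_integral_approxIndicator (hB c).isClosed_compl ν)
      rw [probReal_compl_eq_one_sub (hB c).measurableSet] at h1
      obtain ⟨k, hk⟩ := (h1.eventually_lt_const (u := 1) (by linarith [hlt ν hν c])).exists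
      refine ⟨k, ?_⟩
      have i1 := (integrable_of_continuous (ν := ν) (continuous_approxIndicator R k)).const_mul 4
      have i2 := integrable_of_continuous (ν := ν) (continuous_approxIndicator (B c)ᶜ k)
      have i3 : Integrable (fun _ : X => (1 : ℝ)) ν := integrable_const 1
      have e1 : ∫ x, (4 * approxIndicator R k x + approxIndicator (B c)ᶜ k x - 1) ∂ν =
          ∫ x, (4 * approxIndicator R k x + approxIndicator (B c)ᶜ k x) ∂ν - ∫ _x, 1 ∂ν :=
        integral_sub (i1.add i2) i3
      rw [e1, integral_add i1 i2, integral_const_mul]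
      simp only [integral_const, probReal_univ, smul_eq_mul, mul_one]
      linarith
  choose k n₀ hk using key
  obtain ⟨Y, h, hYo, hYh, hYd, hYc⟩ :=
    hE.exists_towers hmin htf (n := n₀ 0 + n₀ 1 + n₀ 2 + 1) (by omega)
  have hc : ∀ c, n₀ c ≤ h c := by
    intro c
    refine le_trans ?_ (hYh c)
    fin_cases c <;> simp only [Fin.zero_eta, Fin.mk_one, Fin.reduceFinMk] <;> omega
  have hsub : ∀ c, Subord G X (R ∩ ⋃ j ∈ Finset.range (h c), t ^ j • Y c) (B c) := by
    intro c
    refine subord_inter_tower (hYo c) (hYd c) (f := approxIndicator R (k c))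
      (φ := fun x => 1 - approxIndicator (B c)ᶜ (k c) x) (continuous_approxIndicator _ _)
      (continuous_const.sub (continuous_approxIndicator _ _)) (approxIndicator_nonneg _ _)
      (fun x => by linarith [approxIndicator_nonneg (B c)ᶜ (k c) x])
      (fun x hx => approxIndicator_of_mem _ hx) (fun x hx => ?_) (fun x => ?_)
    · by_contra hxB
      rw [approxIndicator_of_mem (k c) (A := (B c)ᶜ) hxB] at hx
      linarith
    · have h1 := hk c (h c) (hc c) x
      rw [Finset.mul_sum, ← sub_neg, ← Finset.sum_sub_distrib]
      refine lt_of_eq_of_lt (Finset.sum_congr rfl fun j _ => ?_) h1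
      ring
  have h01 : Disjoint (B 0) (B 1) := hBd (by decide)
  have h02 : Disjoint (B 0) (B 2) := hBd (by decide)
  have h12 : Disjoint (B 1) (B 2) := hBd (by decide)
  refine (((hsub 0).union (hsub 1) h01).union (hsub 2) (h02.union_left h12)).mono ?_ ?_
  · rw [← Set.inter_union_distrib_left, ← Set.inter_union_distrib_left]
    refine Set.subset_inter le_rfl fun x _ => ?_
    have hx : x ∈ ⋃ c, ⋃ j ∈ Finset.range (h c), t ^ j • Y c := hYc ▸ Set.mem_univ x
    obtain ⟨c, hc⟩ := Set.mem_iUnion.1 hx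
    fin_cases c
    · exact Or.inl (Or.inl hc)
    · exact Or.inl (Or.inr hc)
    · exact Or.inr hc
  · exact Set.union_subset (Set.union_subset (Set.subset_iUnion B 0) (Set.subset_iUnion B 1))
      (Set.subset_iUnion B 2)

end Comparison

section Castle

variable {G : Type*} [Group G] {t : G} {E : Finset G}
variable {X : Type*} [MulAction G X] [MetricSpace X] [CompactSpace X]
  [MeasurableSpace X] [BorelSpace X] [ContinuousConstSMul G X]

omit [CompactSpace X] [BorelSpace X] in
theorem measure_frontier_biUnion {μ : Measure X} {ι : Type*} (s : Finset ι) {f : ι → Set X}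
    (hf : ∀ i ∈ s, μ (frontier (f i)) = 0) :
    μ (frontier (⋃ i ∈ s, f i)) = 0 := by
  classical
  induction s using Finset.induction_on with
  | empty => simp
  | insert i s _ ih =>
    rw [Finset.set_biUnion_insert]
    have h1 := ih fun j hj => hf j (Finset.mem_insert_of_mem hj)
    have h2 := hf i (Finset.mem_insert_self i s)
    refine measure_mono_null (frontier_union_subset _ _) (measure_union_null ?_ ?_)
    · exact measure_mono_null Set.inter_subset_left h2
    · exact measure_mono_null Set.inter_subset_right h1

/-- The base of an open tower with shape `box t E N`, with small levels and null boundary. -/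
structure IsBoxBase (t : G) (E : Finset G) (ε : ℝ) (N : ℕ) (W : Set X) : Prop where
  isOpen : IsOpen W
  null : ∀ μ : Measure X, InvProb G X μ → μ (frontier W) = 0
  disjoint : ∀ g ∈ box t E N, ∀ h ∈ box t E N, g ≠ h → Disjoint (g • W) (h • W)
  diam_lt : ∀ g ∈ box t E N, Metric.diam (g • W) < ε

omit [BorelSpace X] [ContinuousConstSMul G X] in
theorem IsBoxBase.mono {ε : ℝ} {N : ℕ} {U W : Set X} (h : IsBoxBase t E ε N U) (hWU : W ⊆ U)
    (hW : IsOpen W) (hnull : ∀ μ : Measure X, InvProb G X μ → μ (frontier W) = 0) :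
    IsBoxBase t E ε N W where
  isOpen := hW
  null := hnull
  disjoint g hg k hk hne :=
    (h.disjoint g hg k hk hne).mono (Set.smul_set_mono hWU) (Set.smul_set_mono hWU)
  diam_lt g hg := (Metric.diam_mono (Set.smul_set_mono hWU)
    (Metric.isBounded_of_compactSpace)).trans_lt (h.diam_lt g hg)

/-- Disjointness of the towers with shapes `box t E p.1` and bases `p.2`. -/
def BoxDisjoint (t : G) (E : Finset G) (p q : ℕ × Set X) : Prop :=
  ∀ g ∈ box t E p.1, ∀ h ∈ box t E q.1, Disjoint (g • p.2) (h • q.2)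

/-- A castle all of whose shapes are boxes of size at least `N₀`. -/
structure IsBoxCastle (t : G) (E : Finset G) (ε : ℝ) (N₀ : ℕ) (l : List (ℕ × Set X)) : Prop where
  pairwise : l.Pairwise (BoxDisjoint t E)
  base : ∀ p ∈ l, IsBoxBase t E ε p.1 p.2
  le : ∀ p ∈ l, N₀ ≤ p.1

/-- The union of the levels of a list of towers, with the shape of the tower with index `N`
given by `S N`. -/
def listUnion (S : ℕ → Finset G) : List (ℕ × Set X) → Set X
  | [] => ∅
  | p :: l => (⋃ g ∈ S p.1, g • p.2) ∪ listUnion S l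

omit [MetricSpace X] [CompactSpace X] [MeasurableSpace X] [BorelSpace X]
  [ContinuousConstSMul G X] in
theorem mem_listUnion {S : ℕ → Finset G} {l : List (ℕ × Set X)} {x : X} :
    x ∈ listUnion S l ↔ ∃ p ∈ l, ∃ g ∈ S p.1, x ∈ g • p.2 := by
  induction l with
  | nil => simp [listUnion]
  | cons p l ih => simp [listUnion, ih]

/-- The sum of the sizes of the levels of a list of towers. -/
noncomputable def listMeasure (S : ℕ → Finset G) (ν : Measure X) (l : List (ℕ × Set X)) : ℝ :=
  (l.map fun p => ∑ g ∈ S p.1, ν.real (g • p.2)).sum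

omit [MetricSpace X] [CompactSpace X] [BorelSpace X] [ContinuousConstSMul G X] in
theorem measureReal_listUnion_le (S : ℕ → Finset G) (ν : Measure X) [IsFiniteMeasure ν]
    (l : List (ℕ × Set X)) : ν.real (listUnion S l) ≤ listMeasure S ν l := by
  induction l with
  | nil => simp [listUnion, listMeasure]
  | cons p l ih =>
    simp only [listUnion, listMeasure, List.map_cons, List.sum_cons] at ih ⊢
    exact (measureReal_union_le _ _).trans
      (add_le_add (measureReal_biUnion_finset_le _ _) ih)

omit [CompactSpace X] [MeasurableSpace X] [BorelSpace X] in
theorem isOpen_listUnion {S : ℕ → Finset G} {l : List (ℕ × Set X)} (hl : ∀ p ∈ l, IsOpen p.2) :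
    IsOpen (listUnion S l) := by
  induction l with
  | nil => exact isOpen_empty
  | cons p l ih =>
    simp only [List.mem_cons, forall_eq_or_imp] at hl
    exact (isOpen_biUnion fun g _ => hl.1.smul g).union (ih hl.2)

omit [CompactSpace X] in
theorem InvProb.measure_frontier_listUnion {μ : Measure X} (hμ : InvProb G X μ)
    {S : ℕ → Finset G} {l : List (ℕ × Set X)} (hl : ∀ p ∈ l, μ (frontier p.2) = 0) :
    μ (frontier (listUnion S l)) = 0 := by
  induction l with
  | nil => simp [listUnion]
  | cons p l ih =>
    simp only [List.mem_cons, forall_eq_or_imp] at hl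
    refine measure_mono_null (frontier_union_subset _ _) (measure_union_null ?_ ?_)
    · refine measure_mono_null Set.inter_subset_left (measure_frontier_biUnion _ fun g _ => ?_)
      have : frontier (g • p.2) = g • frontier p.2 :=
        ((Homeomorph.smul g).image_frontier p.2).symm
      rw [this, hμ.measure_smul, hl.1]
    · exact measure_mono_null Set.inter_subset_right (ih hl.2)

omit [CompactSpace X] in
theorem IsBoxCastle.measureReal_listUnion {ε : ℝ} {N₀ : ℕ} {l : List (ℕ × Set X)}
    (hl : IsBoxCastle t E ε N₀ l) {S : ℕ → Finset G} (hS : ∀ N, S N ⊆ box t E N)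
    (ν : Measure X) [IsFiniteMeasure ν] : ν.real (listUnion S l) = listMeasure S ν l := by
  obtain ⟨hp, hb, -⟩ := hl
  induction l with
  | nil => simp [listUnion, listMeasure]
  | cons p l ih =>
    simp only [List.mem_cons, forall_eq_or_imp] at hb
    rw [List.pairwise_cons] at hp
    have ih := ih hp.2 hb.2
    simp only [listUnion, listMeasure, List.map_cons, List.sum_cons] at ih ⊢
    rw [measureReal_union _ (isOpen_listUnion fun q hq => (hb.2 q hq).isOpen).measurableSet
      (measure_ne_top _ _) (measure_ne_top _ _), ih, measureReal_biUnion_finset]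
    · exact fun g hg h hh hne => hb.1.disjoint g (hS _ hg) h (hS _ hh) hne
    · exact fun g _ => (hb.1.isOpen.smul g).measurableSet
    · refine Set.disjoint_left.2 fun x hx hx' => ?_
      obtain ⟨g, hg, hxg⟩ := Set.mem_iUnion₂.1 hx
      obtain ⟨q, hq, h, hh, hxh⟩ := mem_listUnion.1 hx'
      exact Set.disjoint_left.1 (hp.1 q hq g (hS _ hg) h (hS _ hh)) hxg hxh

/-- Towers of a new scale `N` can be added to a castle, so that the bases of the new towers
cover given sets up to the region where the new towers may interact with the castle. -/
theorem IsBoxCastle.exists_append (hE : IsZTransversal t E) {ε : ℝ} {N₀ N : ℕ} (hN : N₀ ≤ N)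
    {l₀ : List (ℕ × Set X)} (hl₀ : IsBoxCastle t E ε N₀ l₀) (us : List (Set X))
    (hus : ∀ U ∈ us, IsBoxBase t E ε N U) :
    ∃ l : List (ℕ × Set X), (∀ p ∈ l, p.1 = N) ∧ IsBoxCastle t E ε N₀ (l ++ l₀) ∧
      ∀ U ∈ us, U ⊆ closure (listUnion (boxQuot t E N) (l ++ l₀)) := by
  induction us with
  | nil => exact ⟨[], by simp, by simpa using hl₀, by simp⟩
  | cons U us ih =>
    simp only [List.mem_cons, forall_eq_or_imp] at hus
    obtain ⟨l, hlN, hl, hcov⟩ := ih hus.2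
    set Z := listUnion (boxQuot t E N) (l ++ l₀) with hZ
    set W := U \ closure Z with hW
    have hWbase : IsBoxBase t E ε N W := by
      refine hus.1.mono Set.sdiff_subset (hus.1.isOpen.sdiff isClosed_closure) fun μ hμ => ?_
      rw [hW, Set.sdiff_eq]
      refine measure_mono_null (frontier_inter_subset _ _) (measure_union_null ?_ ?_)
      · exact measure_mono_null Set.inter_subset_left (hus.1.null μ hμ)
      · refine measure_mono_null Set.inter_subset_right ?_
        rw [frontier_compl]
        exact measure_mono_null frontier_closure_subset
          (hμ.measure_frontier_listUnion fun p hp => (hl.base p hp).null μ hμ)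
    have hsub : listUnion (boxQuot t E N) (((N, W) :: l) ++ l₀) =
        (⋃ g ∈ boxQuot t E N N, g • W) ∪ Z := rfl
    refine ⟨(N, W) :: l, ?_, ⟨?_, ?_, ?_⟩, ?_⟩
    · simpa using fun a b h => hlN (a, b) h
    · rw [List.cons_append, List.pairwise_cons]
      refine ⟨fun q hq g hg h hh => Set.disjoint_left.2 ?_, hl.pairwise⟩
      rintro _ ⟨w, hw, rfl⟩ ⟨v, hv, hvw⟩
      refine hw.2 (subset_closure (mem_listUnion.2 ⟨q, hq, g⁻¹ * h, ?_, v, hv, ?_⟩))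
      · classical
        unfold boxQuot
        convert Finset.mul_mem_mul (Finset.inv_mem_inv hg) hh
      · simp only at hvw ⊢
        rw [mul_smul, hvw, inv_smul_smul]
    · rw [List.cons_append]
      simpa only [List.mem_cons, forall_eq_or_imp] using ⟨hWbase, hl.base⟩
    · rw [List.cons_append]
      simpa only [List.mem_cons, forall_eq_or_imp] using ⟨hN, hl.le⟩
    · rw [hsub, closure_union]
      simp only [List.mem_cons, forall_eq_or_imp]
      refine ⟨fun x hx => ?_, fun V hV => (hcov V hV).trans Set.subset_union_right⟩
      by_cases hxZ : x ∈ closure Z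
      · exact Or.inr hxZ
      · refine Or.inl (subset_closure (Set.mem_biUnion (hE.one_mem_boxQuot N) ?_))
        rw [one_smul]
        exact ⟨hx, hxZ⟩

/-- Up to an open set of small measure, the space is covered by bases of towers of scale `N`. -/
theorem IsZTransversal.exists_cover (hE : IsZTransversal t E) (hfree : EssFree G X)
    (hsbp : SBP G X) {ε : ℝ} (hε : 0 < ε) (N : ℕ) {η : ℝ} (hη : 0 < η) :
    ∃ (O : Set X) (us : List (Set X)), (∀ μ : Measure X, InvProb G X μ → μ.real O ≤ η) ∧
      (∀ U ∈ us, IsBoxBase t E ε N U) ∧ ∀ x ∉ O, ∃ U ∈ us, x ∈ U := by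
  classical
  set S := ((box t E N)⁻¹ * box t E N).erase 1 with hS
  have hcl : IsClosed (⋃ g ∈ S, {x : X | g • x = x}) := isClosed_biUnion_finset fun g _ =>
    isClosed_eq (continuous_const_smul g) continuous_id
  obtain ⟨O, hOo, hOS, hO⟩ := hE.exists_isOpen_measure_le hcl (fun μ hμ => by
    exact (measure_biUnion_null_iff S.countable_toSet).2 fun g hg =>
      hfree g (Finset.ne_of_mem_erase hg) μ hμ) hη
  have hloc : ∀ x : X, ∃ V : Set X, IsOpen V ∧ x ∈ V ∧ (x ∉ O → IsBoxBase t E ε N V) := by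
    intro x
    by_cases hx : x ∈ O
    · exact ⟨Set.univ, isOpen_univ, Set.mem_univ x, fun h => absurd hx h⟩
    have hne : ∀ g ∈ box t E N, ∀ h ∈ box t E N, g ≠ h → g • x ≠ h • x := by
      intro g hg h hh hgh heq
      refine hx (hOS (Set.mem_biUnion (x := g⁻¹ * h) (Finset.mem_erase.2 ⟨?_, ?_⟩) ?_))
      · exact fun h1 => hgh (inv_mul_eq_one.1 h1)
      · exact Finset.mul_mem_mul (Finset.inv_mem_inv hg) hh
      · rw [Set.mem_ofPred_eq, mul_smul, ← heq, inv_smul_smul]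
    obtain ⟨W, hWo, hxW, hWd⟩ := exists_isOpen_disjoint_smul hne
    have hUo : IsOpen (W ∩ ⋂ g ∈ box t E N, (fun y => g • y) ⁻¹' Metric.ball (g • x) (ε / 4)) :=
      hWo.inter (isOpen_biInter_finset fun g _ =>
        Metric.isOpen_ball.preimage (continuous_const_smul g))
    obtain ⟨V, hVo, hxV, hVU, hVn⟩ := hsbp x _ hUo ⟨hxW, by
      simp only [Set.mem_iInter, Set.mem_preimage]
      exact fun g _ => Metric.mem_ball_self (by linarith)⟩
    have hVW := hVU.trans Set.inter_subset_left
    refine ⟨V, hVo, hxV, fun _ => ⟨hVo, hVn, fun g hg h hh hgh => ?_, fun g hg => ?_⟩⟩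
    · exact (hWd g hg h hh hgh).mono (Set.smul_set_mono hVW) (Set.smul_set_mono hVW)
    · have hsub : g • V ⊆ Metric.ball (g • x) (ε / 4) := by
        rintro _ ⟨y, hy, rfl⟩
        exact Set.mem_iInter₂.1 (hVU hy).2 g hg
      have := Metric.diam_mono hsub Metric.isBounded_ball
      have := Metric.diam_ball (x := g • x) (r := ε / 4) (by linarith)
      linarith
  choose V hVo hxV hVb using hloc
  obtain ⟨s, hs, hcov⟩ := hOo.isClosed_compl.isCompact.elim_nhds_subcover V
    fun x _ => (hVo x).mem_nhds (hxV x)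
  refine ⟨O, s.toList.map V, hO, ?_, ?_⟩
  · intro U hU
    obtain ⟨x, hx, rfl⟩ := List.mem_map.1 hU
    exact hVb x (hs x (Finset.mem_toList.1 hx))
  · intro x hx
    obtain ⟨y, hy, hxy⟩ := Set.mem_iUnion₂.1 (hcov hx)
    exact ⟨V y, List.mem_map.2 ⟨y, Finset.mem_toList.2 hy, rfl⟩, hxy⟩

end Castle

section Exhaustion

variable {G : Type*} [Group G] {t : G} {E : Finset G}
variable {X : Type*} [MulAction G X] [MetricSpace X] [CompactSpace X]
  [MeasurableSpace X] [BorelSpace X] [ContinuousConstSMul G X]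

omit [MetricSpace X] [CompactSpace X] [BorelSpace X] [ContinuousConstSMul G X] in
theorem listMeasure_append (S : ℕ → Finset G) (ν : Measure X) (l l' : List (ℕ × Set X)) :
    listMeasure S ν (l ++ l') = listMeasure S ν l + listMeasure S ν l' := by
  simp [listMeasure]

omit [MetricSpace X] [CompactSpace X] [BorelSpace X] [ContinuousConstSMul G X] in
theorem listMeasure_le_mul {S T : ℕ → Finset G} {ν : Measure X} {l : List (ℕ × Set X)} {c : ℝ}
    (h : ∀ p ∈ l, ∑ g ∈ S p.1, ν.real (g • p.2) ≤ c * ∑ g ∈ T p.1, ν.real (g • p.2)) :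
    listMeasure S ν l ≤ c * listMeasure T ν l := by
  rw [listMeasure, listMeasure, ← List.sum_map_mul_left]
  exact List.sum_le_sum h

omit [CompactSpace X] in
theorem InvProb.listMeasure_le_mul {μ : Measure X} (hμ : InvProb G X μ) {S T : ℕ → Finset G}
    {l : List (ℕ × Set X)} {c : ℝ}
    (h : ∀ p ∈ l, ((S p.1).card : ℝ) ≤ c * (T p.1).card) :
    listMeasure S μ l ≤ c * listMeasure T μ l := by
  refine Paper.listMeasure_le_mul fun p hp => ?_
  simp only [measureReal_def, hμ.measure_smul, Finset.sum_const, nsmul_eq_mul]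
  rw [← mul_assoc]
  exact mul_le_mul_of_nonneg_right (h p hp) ENNReal.toReal_nonneg

omit [CompactSpace X] in
theorem IsZTransversal.sum_slab (hE : IsZTransversal t E) {ν : Measure X}
    (hν : IsInvariantProb t ν) (I : Finset ℤ) {W : Set X} (hW : IsOpen W) :
    ∑ g ∈ slab t E I, ν.real (g • W) = I.card * ∑ e ∈ E, ν.real (e • W) := by
  classical
  rw [slab, Finset.sum_image, Finset.sum_product]
  · simp only [mul_smul, measureReal_def, hν.measure_zpow_smul _ (hW.smul _).measurableSet,
      Finset.sum_const, nsmul_eq_mul]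
  · rintro ⟨i, e⟩ h ⟨j, f⟩ h' hij
    simp only [Finset.coe_product, Set.mem_prod, Finset.mem_coe] at h h'
    obtain ⟨h1, h2⟩ := hE.inj i j e h.2 f h'.2 hij
    rw [h1, h2]

/-- Adding towers of a suitable smaller scale to a castle reduces by a definite factor the measure
of the part of the space that is not covered. -/
theorem IsBoxCastle.exists_improve (hE : IsZTransversal t E) (hfree : EssFree G X)
    (hsbp : SBP G X) {ε : ℝ} (hε : 0 < ε) {N₀ N M₀ : ℕ} {η : ℝ} (hη : 0 < η) (hN : N₀ ≤ N)
    (hquot : ((boxQuot t E N N).card : ℝ) ≤ 3 * (box t E N).card)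
    (hquot' : ∀ M ≥ M₀, ((boxQuot t E N M).card : ℝ) ≤ (1 + η) * (box t E M).card)
    {l₀ : List (ℕ × Set X)} (hl₀ : IsBoxCastle t E ε (max N₀ M₀) l₀) :
    ∃ l, IsBoxCastle t E ε N₀ l ∧ ∀ μ : Measure X, InvProb G X μ →
      1 - listMeasure (box t E) μ l ≤ 2 / 3 * (1 - listMeasure (box t E) μ l₀) + 2 / 3 * η := by
  obtain ⟨O, us, hO, hus, hcov⟩ := hE.exists_cover hfree hsbp hε N hη
  have hl₀' : IsBoxCastle t E ε N₀ l₀ :=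
    ⟨hl₀.pairwise, hl₀.base, fun p hp => (le_max_left _ _).trans (hl₀.le p hp)⟩
  obtain ⟨l, hlN, hl, hZ⟩ := hl₀'.exists_append hE hN us hus
  refine ⟨l ++ l₀, hl, fun μ hμ => ?_⟩
  have := hμ.1
  set Z := listUnion (boxQuot t E N) (l ++ l₀)
  have huniv : (Set.univ : Set X) ⊆ O ∪ (Z ∪ frontier Z) := by
    intro x _
    by_cases hx : x ∈ O
    · exact Or.inl hx
    · obtain ⟨U, hU, hxU⟩ := hcov x hx
      rw [← closure_eq_self_union_frontier]
      exact Or.inr (hZ U hU hxU)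
  have h1 : (1 : ℝ) ≤ μ.real O + (μ.real Z + μ.real (frontier Z)) := by
    calc (1 : ℝ) = μ.real Set.univ := by simp
      _ ≤ μ.real (O ∪ (Z ∪ frontier Z)) := measureReal_mono huniv
      _ ≤ _ := (measureReal_union_le _ _).trans
        (add_le_add le_rfl (measureReal_union_le _ _))
  have h2 : μ.real (frontier Z) = 0 := by
    rw [measureReal_def, hμ.measure_frontier_listUnion fun p hp => (hl.base p hp).null μ hμ]
    rfl
  have h3 : μ.real Z ≤ _ := measureReal_listUnion_le _ μ _
  have h4 : listMeasure (boxQuot t E N) μ l ≤ 3 * listMeasure (box t E) μ l :=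
    hμ.listMeasure_le_mul fun p hp => by rw [hlN p hp]; exact hquot
  have h5 : listMeasure (boxQuot t E N) μ l₀ ≤ (1 + η) * listMeasure (box t E) μ l₀ :=
    hμ.listMeasure_le_mul fun p hp => hquot' _ ((le_max_right _ _).trans (hl₀.le p hp))
  have h6 : listMeasure (box t E) μ l₀ ≤ 1 := by
    rw [← hl₀.measureReal_listUnion fun _ => subset_rfl]
    exact measureReal_le_one
  have h7 := hO μ hμ
  rw [listMeasure_append] at h3 ⊢
  have h8 := mul_le_mul_of_nonneg_left h6 hη.le
  linarith

/-- There are box castles whose complement has small measure for all invariant measures. -/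
theorem IsZTransversal.exists_isBoxCastle (hE : IsZTransversal t E) (hfree : EssFree G X)
    (hsbp : SBP G X) {ε : ℝ} (hε : 0 < ε) {δ : ℝ} (hδ : 0 < δ) (N₀ : ℕ) :
    ∃ l, IsBoxCastle t E ε N₀ l ∧ ∀ μ : Measure X, InvProb G X μ →
      1 - listMeasure (box t E) μ l ≤ δ := by
  classical
  have key : ∀ n N₀ : ℕ, ∃ l, IsBoxCastle t E ε N₀ l ∧ ∀ μ : Measure X, InvProb G X μ →
      1 - listMeasure (box t E) μ l ≤ (5 / 6) ^ n := by
    intro n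
    induction n with
    | zero => exact fun N₀ => ⟨[], ⟨by simp, by simp, by simp⟩, by simp [listMeasure]⟩
    | succ n ih =>
      intro N₀
      obtain ⟨N₁, hN₁⟩ := hE.eventually_card_boxQuot_self
      have hη : (0 : ℝ) < 1 / 6 * (5 / 6) ^ n := by positivity
      obtain ⟨M₀, hM₀⟩ := hE.eventually_card_boxQuot_sdiff (max N₀ N₁) hη
      obtain ⟨l₀, hl₀, hμl₀⟩ := ih (max N₀ M₀)
      obtain ⟨l, hl, hμl⟩ := hl₀.exists_improve hE hfree hsbp hε hη (le_max_left N₀ N₁)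
        (hN₁ _ (le_max_right _ _)) fun M hM => by
          have h1 := hM₀ M hM
          have h2 : ((boxQuot t E (max N₀ N₁) M).card : ℝ) ≤
              (boxQuot t E (max N₀ N₁) M \ box t E M).card + (box t E M).card := by
            exact_mod_cast Finset.card_le_card_sdiff_add_card
          have h3 : (boxQuot t E (max N₀ N₁) M \ box t E M).card = _ := rfl
          linarith
      refine ⟨l, hl, fun μ hμ => (hμl μ hμ).trans ?_⟩
      have := hμl₀ μ hμ
      have h : (0 : ℝ) < (5 / 6) ^ n := by positivity
      rw [pow_succ]
      linarith
  obtain ⟨n, hn⟩ := exists_pow_lt_of_lt_one hδ (show (5 / 6 : ℝ) < 1 by norm_num)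
  obtain ⟨l, hl, h⟩ := key n N₀
  exact ⟨l, hl, fun μ hμ => (h μ hμ).trans hn.le⟩

end Exhaustion

section Final

variable {G : Type*} [Group G] {t : G} {E : Finset G}
variable {X : Type*} [MulAction G X] [MetricSpace X] [MeasurableSpace X]

theorem IsBoxCastle.isCastle {ε : ℝ} {N₀ : ℕ} {l : List (ℕ × Set X)}
    (hl : IsBoxCastle t E ε N₀ l) :
    IsCastle G X (fun i : Fin l.length => box t E (l.get i).1) fun i => (l.get i).2 := by
  intro i j g hg h hh hne
  rcases lt_trichotomy i j with hij | rfl | hij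
  · exact List.pairwise_iff_get.1 hl.pairwise i j hij g hg h hh
  · exact (hl.base _ (l.get_mem i)).disjoint g hg h hh fun hgh => hne (by rw [hgh])
  · exact (List.pairwise_iff_get.1 hl.pairwise j i hij h hh g hg).symm

omit [MeasurableSpace X] [MetricSpace X] in
theorem castleUnion_get (S : ℕ → Finset G) (l : List (ℕ × Set X)) :
    CastleUnion G X (fun i : Fin l.length => S (l.get i).1) (fun i => (l.get i).2) =
      listUnion S l := by
  ext x
  simp only [CastleUnion, Set.mem_iUnion, mem_listUnion, exists_prop, List.mem_iff_get]
  constructor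
  · rintro ⟨i, g, hg, hx⟩
    exact ⟨_, ⟨i, rfl⟩, g, hg, hx⟩
  · rintro ⟨_, ⟨i, rfl⟩, g, hg, hx⟩
    exact ⟨i, g, hg, hx⟩

theorem IsBoxCastle.disjoint_listUnion {ε : ℝ} {N₀ : ℕ} {l : List (ℕ × Set X)}
    (hl : IsBoxCastle t E ε N₀ l) {S T : ℕ → Finset G} (hS : ∀ N, S N ⊆ box t E N)
    (hT : ∀ N, T N ⊆ box t E N) (hST : ∀ N, Disjoint (S N) (T N)) :
    Disjoint (listUnion S l) (listUnion T l) := by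
  simp only [← castleUnion_get, CastleUnion, Set.disjoint_iUnion_left, Set.disjoint_iUnion_right]
  refine fun j h hh i g hg => hl.isCastle i j g (hS _ hg) h (hT _ hh) fun heq => ?_
  obtain ⟨rfl, rfl⟩ := Prod.mk.injEq .. ▸ heq
  exact Finset.disjoint_left.1 (hST _) hg hh

theorem IsZTransversal.disjoint_slab (hE : IsZTransversal t E) {I J : Finset ℤ}
    (h : Disjoint I J) : Disjoint (slab t E I) (slab t E J) := by
  refine Finset.disjoint_left.2 fun g hg hg' => ?_
  obtain ⟨i, hi, e, he, rfl⟩ := mem_slab.1 hg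
  obtain ⟨j, hj, f, hf, hij⟩ := mem_slab.1 hg'
  obtain ⟨rfl, -⟩ := hE.inj j i f hf e he hij
  exact Finset.disjoint_left.1 h hi hj

end Final

section Main

variable {G : Type*} [Group G] {t : G} {E : Finset G}
variable {X : Type*} [MulAction G X] [MetricSpace X]

/-- The `c`-th of consecutive intervals of length `(2 * N + 1) / (4 * m)`. -/
noncomputable def subinterval (m : ℕ) (c : ℤ) (N : ℕ) : Finset ℤ :=
  Finset.Ico (-(N : ℤ) + c * ((2 * N + 1) / (4 * m) : ℕ))
    (-(N : ℤ) + (c + 1) * ((2 * N + 1) / (4 * m) : ℕ))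

theorem card_subinterval (m : ℕ) (c : ℤ) (N : ℕ) :
    (subinterval m c N).card = (2 * N + 1) / (4 * m) := by
  rw [subinterval, Int.card_Ico, add_one_mul]
  generalize (2 * N + 1) / (4 * m) = q
  omega

theorem disjoint_subinterval (m : ℕ) {c c' : ℤ} (h : c ≠ c') (N : ℕ) :
    Disjoint (subinterval m c N) (subinterval m c' N) := by
  wlog hlt : c < c' generalizing c c'
  · exact (this h.symm (lt_of_le_of_ne (not_lt.1 hlt) h.symm)).symm
  refine Finset.disjoint_left.2 fun i hi hi' => ?_
  rw [subinterval, Finset.mem_Ico] at hi hi'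
  have : (c + 1) * (((2 * N + 1) / (4 * m) : ℕ) : ℤ) ≤ c' * ((2 * N + 1) / (4 * m) : ℕ) :=
    mul_le_mul_of_nonneg_right hlt (Int.natCast_nonneg _)
  linarith [hi.2, hi'.1]

/-- An initial part of the interval from `-N` to `N`. -/
noncomputable def initialInterval (m N : ℕ) : Finset ℤ :=
  Finset.Ico (-(N : ℤ)) (-(N : ℤ) + 3 * ((2 * N + 1) / (4 * m) : ℕ))

theorem subinterval_subset (m : ℕ) (c : Fin 3) (N : ℕ) :
    subinterval m (c : ℕ) N ⊆ initialInterval m N := by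
  rw [subinterval, initialInterval]
  generalize (2 * N + 1) / (4 * m) = q
  refine Finset.Ico_subset_Ico ?_ ?_ <;> fin_cases c <;> simp <;> omega

theorem initialInterval_subset {m : ℕ} (hm : 0 < m) (N : ℕ) :
    initialInterval m N ⊆ Finset.Icc (-(N : ℤ)) N := by
  have h : 4 * m * ((2 * N + 1) / (4 * m)) ≤ 2 * N + 1 := Nat.mul_div_le _ _
  have h' : 4 * 1 * ((2 * N + 1) / (4 * m)) ≤ 4 * m * ((2 * N + 1) / (4 * m)) := by gcongr; omega
  intro i hi
  rw [initialInterval, Finset.mem_Ico] at hi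
  rw [Finset.mem_Icc]
  omega

theorem IsZTransversal.card_initialInterval (hE : IsZTransversal t E) {m N : ℕ} (hm : 0 < m)
    (hN : 4 * m ≤ 2 * N + 1) :
    ((slab t E (initialInterval m N)).card : ℝ) < (box t E N).card / m := by
  have hm' : (0 : ℝ) < m := by exact_mod_cast hm
  have hq : 0 < (2 * N + 1) / (4 * m) := Nat.div_pos hN (by omega)
  have h : 4 * m * ((2 * N + 1) / (4 * m)) ≤ 2 * N + 1 := Nat.mul_div_le _ _
  have hc : (initialInterval m N).card = 3 * ((2 * N + 1) / (4 * m)) := by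
    rw [initialInterval, Int.card_Ico]
    omega
  rw [lt_div_iff₀ hm', hE.card_slab, hE.card_box, hc]
  have : 3 * ((2 * N + 1) / (4 * m)) * E.card * m < (2 * N + 1) * E.card := by
    calc 3 * ((2 * N + 1) / (4 * m)) * E.card * m
        = (3 * m * ((2 * N + 1) / (4 * m))) * E.card := by ring
      _ < (2 * N + 1) * E.card := by
        refine Nat.mul_lt_mul_of_pos_right (lt_of_lt_of_le ?_ h) hE.card_pos
        exact Nat.mul_lt_mul_of_pos_right (by omega) hq
  exact_mod_cast this

variable [CompactSpace X] [MeasurableSpace X] [BorelSpace X] [ContinuousConstSMul G X]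

/-- If a box castle covers most of the space in measure, its complement is subordinate to a small
part of it. -/
theorem IsBoxCastle.subord_compl [Nonempty X] (hE : IsZTransversal t E) (hmin : Minimal G X)
    (htf : TopFree G X) {ε : ℝ} {N₀ m : ℕ} (hm : 0 < m) (hN₀ : 4 * m ≤ 2 * N₀ + 1)
    {l : List (ℕ × Set X)} (hl : IsBoxCastle t E ε N₀ l)
    (hμ : ∀ μ : Measure X, InvProb G X μ →
      1 - listMeasure (box t E) μ l ≤ 1 / (100 * m * E.card)) :
    Subord G X (Set.univ \ listUnion (box t E) l)
      (listUnion (fun N => slab t E (initialInterval m N)) l) := by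
  have hm1 : (1 : ℝ) ≤ m := by exact_mod_cast hm
  have hd : (0 : ℝ) < E.card := by exact_mod_cast hE.card_pos
  have hopen : ∀ S : ℕ → Finset G, IsOpen (listUnion S l) := fun S =>
    isOpen_listUnion fun p hp => (hl.base p hp).isOpen
  have hsub : ∀ (c : Fin 3) N, slab t E (subinterval m (c : ℕ) N) ⊆ box t E N := fun c N =>
    slab_mono ((subinterval_subset m c N).trans (initialInterval_subset hm N))
  have hcompl : ∀ ν : Measure X, IsProbabilityMeasure ν →
      ν.real (Set.univ \ listUnion (box t E) l) = 1 - listMeasure (box t E) ν l := by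
    intro ν _
    rw [← hl.measureReal_listUnion (fun _ => subset_rfl) ν, ← Set.compl_eq_univ_sdiff]
    exact probReal_compl_eq_one_sub (hopen _).measurableSet
  refine (hE.subord_of_measure_lt hmin htf ((isClosed_univ).sdiff (hopen _))
    (B := fun c : Fin 3 => listUnion (fun N => slab t E (subinterval m (c : ℕ) N)) l)
    (fun c => hopen _) (fun c c' hcc => ?_) fun ν hν c => ?_).mono subset_rfl ?_
  · exact hl.disjoint_listUnion (hsub c) (hsub c') fun N =>
      hE.disjoint_slab (disjoint_subinterval m (by simpa [Fin.ext_iff] using hcc) N)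
  · have := hν.1
    obtain ⟨μ, hμinv, hνμ⟩ := hE.exists_invProb hν
    have := hμinv.1
    have h1 : ν.real (Set.univ \ listUnion (box t E) l) ≤ 1 / (100 * m) := by
      calc ν.real (Set.univ \ listUnion (box t E) l)
          ≤ E.card * μ.real (Set.univ \ listUnion (box t E) l) := by
            have := ENNReal.toReal_mono (ENNReal.mul_ne_top (ENNReal.natCast_ne_top _)
              (measure_ne_top μ _)) (hνμ (Set.univ \ listUnion (box t E) l))
            simpa [measureReal_def] using this
        _ ≤ E.card * (1 / (100 * m * E.card)) := by
            rw [hcompl μ inferInstance]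
            exact mul_le_mul_of_nonneg_left (hμ μ hμinv) hd.le
        _ = 1 / (100 * m) := by field_simp
    have h2 : listMeasure (box t E) ν l ≤
        8 * m * listMeasure (fun N => slab t E (subinterval m (c : ℕ) N)) ν l := by
      refine listMeasure_le_mul fun p hp => ?_
      rw [box, hE.sum_slab hν _ (hl.base p hp).isOpen, hE.sum_slab hν _ (hl.base p hp).isOpen,
        ← mul_assoc, card_subinterval]
      refine mul_le_mul_of_nonneg_right ?_ (Finset.sum_nonneg fun _ _ => measureReal_nonneg)
      have hN : 4 * m ≤ 2 * p.1 + 1 := by have := hl.le p hp; omega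
      have h3 : 0 < (2 * p.1 + 1) / (4 * m) := Nat.div_pos hN (by omega)
      have h4 : 2 * p.1 + 1 < 4 * m * ((2 * p.1 + 1) / (4 * m) + 1) :=
        Nat.lt_mul_div_succ _ (by omega)
      have h5 : 4 * m * 1 ≤ 4 * m * ((2 * p.1 + 1) / (4 * m)) := Nat.mul_le_mul_left _ h3
      have h6 : (Finset.Icc (-(p.1 : ℤ)) p.1).card = 2 * p.1 + 1 := by
        rw [Int.card_Icc]
        omega
      rw [h6]
      have : 2 * p.1 + 1 ≤ 8 * m * ((2 * p.1 + 1) / (4 * m)) := by linarith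
      exact_mod_cast this
    have h3 := hcompl ν inferInstance
    rw [hl.measureReal_listUnion (hsub c) ν]
    have h4 : 1 / (100 * (m : ℝ)) ≤ 1 / 100 := by
      apply one_div_le_one_div_of_le <;> linarith
    have h5 : (m : ℝ) * (1 / (100 * m)) = 1 / 100 := by field_simp
    by_contra! hcon
    have h6 := mul_le_mul_of_nonneg_left (hcon.trans
      (mul_le_mul_of_nonneg_left h1 zero_le_four)) (by linarith : (0 : ℝ) ≤ 8 * m)
    linarith
  · refine Set.iUnion_subset fun c x hx => ?_
    obtain ⟨p, hp, g, hg, hxg⟩ := mem_listUnion.1 hx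
    exact mem_listUnion.2 ⟨p, hp, g, slab_mono (subinterval_subset m c _) hg, hxg⟩

end Main

end Paper

open Paper

theorem almostFinite_of_virtuallyZ_minimal_topFree_sbp
    (G : Type*) [Group G] [Countable G] (hvz : VirtuallyZ G)
    (X : Type*) [MetricSpace X] [CompactSpace X] [Infinite X]
    [MeasurableSpace X] [BorelSpace X]
    [MulAction G X] [ContinuousConstSMul G X]
    (hmin : Minimal G X) (htf : TopFree G X) (hsbp : SBP G X) :
    AlmostFinite G X := by
  intro K m hm ε hε
  obtain ⟨t, E, hE⟩ := hvz.exists_isZTransversal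
  obtain ⟨N₁, hN₁⟩ := hE.eventually_isFolner_box K hε
  have hδ : (0 : ℝ) < 1 / (100 * m * E.card) := by
    have := hE.card_pos
    positivity
  obtain ⟨l, hl, hμ⟩ := hE.exists_isBoxCastle (hE.essFree hmin htf) hsbp hε hδ (max N₁ (2 * m))
  have hle : ∀ i : Fin l.length, max N₁ (2 * m) ≤ (l.get i).1 := fun i => hl.le _ (l.get_mem i)
  refine ⟨l.length, fun i => box t E (l.get i).1, fun i => (l.get i).2, hl.isCastle,
    fun i => (hl.base _ (l.get_mem i)).isOpen,
    fun i => hN₁ _ ((le_max_left _ _).trans (hle i)),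
    fun i => (hl.base _ (l.get_mem i)).diam_lt,
    fun i => slab t E (initialInterval m (l.get i).1), fun i => ⟨?_, ?_⟩, ?_⟩
  · exact slab_mono (initialInterval_subset hm _)
  · exact hE.card_initialInterval hm (by have := hle i; omega)
  · rw [castleUnion_get (box t E) l, castleUnion_get (fun N => slab t E (initialInterval m N)) l]
    exact hl.subord_compl hE hmin htf hm (by omega) hμ
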